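/- arXiv:2004.11896 — 3 statements merged into one kernel-verified Lean document; each statement's English description precedes it below -/
import Mathlib

section
/- Let m ≥ 2 and k be positive integers with gcd(k,m) = 1 and let β ∈ F_{2^m}, β ≠ 0. The Taniguchi function f_{k,0,β} on F_{2^m} × F_{2^m} is APN if and only if m is even and β is a non-cube in F_{2^m}^*. -/
/-- A function `F` on (the additive group of) a finite field of characteristic 2 is
almost perfect nonlinear (APN) if for every nonzero `a` and every `b`, the equation
`F (x + a) + F x = b` has exactly 0 or 2 solutions `x`. -/
def IsAPN {G : Type*} [AddCommGroup G] (F : G → G) : Prop :=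
  ∀ a : G, a ≠ 0 → ∀ b : G,
    {x : G | F (x + a) + F x = b}.ncard = 0 ∨ {x : G | F (x + a) + F x = b}.ncard = 2

/-- The Taniguchi function `f_{k,α,β}` on `K × K`. -/
def taniguchi {K : Type*} [Field K] (k : ℕ) (α β : K) : K × K → K × K :=
  fun p => (p.1 ^ (2 ^ (2 * k) * (2 ^ k + 1)) + α * p.1 ^ (2 ^ (2 * k)) * p.2 ^ (2 ^ k)
      + β * p.2 ^ (2 ^ k + 1), p.1 * p.2)

/-- `f_{k,0,β}` in terms of the ring endomorphism `s = x ↦ x^(2^k)`. -/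
theorem tani_eq {K : Type*} [Field K] [CharP K 2] (k : ℕ) (β : K) (p : K × K) :
    taniguchi k 0 β p =
      (iterateFrobenius K 2 k (iterateFrobenius K 2 k p.1) *
        iterateFrobenius K 2 k (iterateFrobenius K 2 k (iterateFrobenius K 2 k p.1)) +
        β * (iterateFrobenius K 2 k p.2 * p.2), p.1 * p.2) := by
  simp only [taniguchi, iterateFrobenius_def]
  congr 1
  ring

/-- The derivative condition, reduced to a bilinear one. -/
theorem bilin_of_eq {K : Type*} [Field K] [CharP K 2] (s : K →+* K) (β : K) (z w a : K × K)
    (F : K × K → K × K)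
    (hF : ∀ p, F p = (s (s p.1) * s (s (s p.1)) + β * (s p.2 * p.2), p.1 * p.2))
    (h : F (z + w + a) + F (z + w) = F (z + a) + F z) :
    s (s (s w.1)) * s (s a.1) + s (s w.1) * s (s (s a.1)) + β * (s w.2 * a.2 + w.2 * s a.2) = 0 ∧
      w.1 * a.2 + a.1 * w.2 = 0 := by
  have h2 : (2 : K) = 0 := CharTwo.two_eq_zero
  simp only [hF, Prod.ext_iff, Prod.fst_add, Prod.snd_add, map_add] at h
  obtain ⟨h1, h3⟩ := h
  constructor
  · linear_combination h1 - ((s (s z.1) + s (s w.1)) * (s (s (s z.1)) + s (s (s w.1)))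
      + β * ((s z.2 + s w.2) * (z.2 + w.2))
      - (s (s z.1) * s (s (s z.1)) + β * (s z.2 * z.2))) * h2
  · linear_combination h3 - ((z.1+w.1)*(z.2+w.2) - z.1*z.2) * h2

theorem fix_of {m k : ℕ} (hgcd : Nat.gcd k m = 1) (hm : m ≠ 0) (t : GaloisField 2 m)
    (h : iterateFrobenius (GaloisField 2 m) 2 k t = t) : t = 0 ∨ t = 1 := by
  by_cases ht : t = 0
  · exact Or.inl ht
  right
  rw [iterateFrobenius_def] at h
  have hc : Nat.card (GaloisField 2 m) = 2 ^ m := GaloisField.card 2 m hm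
  have h1 : t ^ (2 ^ k - 1) = 1 := by
    apply mul_right_cancel₀ ht
    rw [← pow_succ, Nat.sub_add_cancel Nat.one_le_two_pow, h, one_mul]
  have : Fintype (GaloisField 2 m) := Fintype.ofFinite _
  have h2 : t ^ (2 ^ m - 1) = 1 := by
    have := FiniteField.pow_card_sub_one_eq_one t ht
    rwa [← Nat.card_eq_fintype_card, hc] at this
  have h3 := pow_gcd_eq_one.2 ⟨h1, h2⟩
  rw [Nat.pow_sub_one_gcd_pow_sub_one, hgcd] at h3
  simpa using h3

theorem power_iff (m k : ℕ) (hm : 2 ≤ m) (hgcd : Nat.gcd k m = 1) (β : GaloisField 2 m)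
    (hβ : β ≠ 0) :
    (∃ c : GaloisField 2 m, c ^ (2 ^ k + 1) = β) ↔
      ¬ (Even m ∧ ∀ γ : GaloisField 2 m, γ ^ 3 ≠ β) := by
  have hc : Nat.card (GaloisField 2 m) = 2 ^ m := GaloisField.card 2 m (by omega)
  have : Fintype (GaloisField 2 m) := Fintype.ofFinite _
  have hdvd : Nat.gcd (2 ^ k + 1) (2 ^ m - 1) ∣ 2 ^ (Nat.gcd (2 * k) m) - 1 := by
    rw [← Nat.pow_sub_one_gcd_pow_sub_one]
    apply Nat.gcd_dvd_gcd_of_dvd_left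
    refine ⟨2 ^ k - 1, ?_⟩
    have := Nat.sq_sub_sq (2 ^ k) 1
    rw [← this, mul_comm 2 k, pow_mul, one_pow]
  -- powers of exponent `d` are powers of exponent `2^k+1`
  have key : ∀ γ : GaloisField 2 m, γ ≠ 0 →
      ∃ c : GaloisField 2 m, c ^ (2 ^ k + 1) = γ ^ (Nat.gcd (2 ^ k + 1) (2 ^ m - 1)) := by
    intro γ hγ
    have h2 : γ ^ (2 ^ m - 1) = 1 := by
      have := FiniteField.pow_card_sub_one_eq_one γ hγ
      rwa [← Nat.card_eq_fintype_card, hc] at this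
    refine ⟨γ ^ (Nat.gcdA (2 ^ k + 1) (2 ^ m - 1)), ?_⟩
    rw [← zpow_natCast γ (Nat.gcd _ _), Nat.gcd_eq_gcd_ab, zpow_add₀ hγ, zpow_mul, zpow_mul,
      zpow_natCast γ (2 ^ m - 1), h2, one_zpow, mul_one, zpow_natCast, ← zpow_natCast, ← zpow_mul,
      mul_comm, zpow_mul, zpow_natCast]
  rcases Nat.even_or_odd m with he | ho
  · have hko : Odd k := by
      by_contra h
      rw [Nat.not_odd_iff_even] at h
      have := Nat.dvd_gcd h.two_dvd he.two_dvd
      omega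
    have hg : Nat.gcd (2 * k) m = 2 := by
      obtain ⟨n, rfl⟩ := he.two_dvd
      rw [Nat.gcd_mul_left, Nat.Coprime.coprime_mul_left_right hgcd]
    rw [hg] at hdvd
    constructor
    · rintro ⟨c, hcc⟩ ⟨-, h⟩
      have h3 : 3 ∣ 2 ^ k + 1 := by
        have := Odd.nat_add_dvd_pow_add_pow 2 1 hko
        simpa using this
      obtain ⟨e, hee⟩ := h3
      apply h (c ^ e)
      rw [← hcc, hee, mul_comm, pow_mul]
    · intro h
      push Not at h
      obtain ⟨γ, hγ⟩ := h he
      have hγ0 : γ ≠ 0 := by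
        rintro rfl
        apply hβ
        rw [← hγ]; simp
      obtain ⟨e, hee⟩ := hdvd
      obtain ⟨c, hcc⟩ := key (γ ^ e) (pow_ne_zero _ hγ0)
      refine ⟨c, ?_⟩
      rw [hcc, ← pow_mul, mul_comm, ← hee, ← hγ]
      norm_num
  · have hg : Nat.gcd (2 * k) m = 1 := by
      apply Nat.Coprime.mul_left _ hgcd
      exact (Nat.coprime_two_left).2 ho
    rw [hg] at hdvd
    constructor
    · rintro - ⟨h, -⟩
      exact (Nat.not_even_iff_odd.2 ho) h
    · rintro -
      obtain ⟨c, hcc⟩ := key β hβ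
      refine ⟨c, ?_⟩
      have h1 : Nat.gcd (2 ^ k + 1) (2 ^ m - 1) = 1 := Nat.dvd_one.1 (by simpa using hdvd)
      rw [hcc, h1, pow_one]

/-- The Taniguchi function `f_{k,0,β}` on `F_{2^m} × F_{2^m}` is APN if and only if
`m` is even and `β` is a non-cube in `F_{2^m}^*`. -/
theorem taniguchi_alpha_zero_apn_iff (m k : ℕ) (hm : 2 ≤ m) (hk : 0 < k)
    (hgcd : Nat.gcd k m = 1) (β : GaloisField 2 m) (hβ : β ≠ 0) :
    IsAPN (taniguchi k (0 : GaloisField 2 m) β) ↔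
      (Even m ∧ ∀ γ : GaloisField 2 m, γ ^ 3 ≠ β) := by
  have h2 : (2 : GaloisField 2 m) = 0 := CharTwo.two_eq_zero
  have hF := tani_eq (K := GaloisField 2 m) k β
  have hfix := fun t => fix_of (k := k) hgcd (by omega) t
  have hs : ∀ x : GaloisField 2 m, x ^ (2 ^ k + 1) = iterateFrobenius _ 2 k x * x := by
    intro x; rw [iterateFrobenius_def, pow_succ]
  rw [← not_iff_not, ← power_iff m k hm hgcd β hβ]
  simp only [hs]
  generalize taniguchi k (0 : GaloisField 2 m) β = F at *
  generalize iterateFrobenius (GaloisField 2 m) 2 k = s at *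
  have sinj : Function.Injective s := s.injective
  have s0 : ∀ x, x ≠ 0 → s x ≠ 0 := fun x hx => (map_ne_zero s).2 hx
  constructor
  · intro hA
    by_contra hP
    push Not at hP
    apply hA
    intro a ha b
    rcases Set.eq_empty_or_nonempty {x | F (x + a) + F x = b} with h | ⟨z, hz⟩
    · left; rw [h]; simp
    right
    have hpair : {x | F (x + a) + F x = b} = {z, z + a} := by
      ext x
      simp only [Set.mem_setOf_eq, Set.mem_insert_iff, Set.mem_singleton_iff] at hz ⊢
      constructor
      · intro hx
        obtain ⟨w, rfl⟩ : ∃ w, x = z + w := ⟨x - z, by abel⟩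
        obtain ⟨e1, e2⟩ := bilin_of_eq s β z w a F hF (hx.trans hz.symm)
        suffices w = 0 ∨ w = a by
          rcases this with rfl | rfl <;> simp
        clear hx hz
        obtain ⟨a, b⟩ := a
        obtain ⟨x, y⟩ := w
        simp only [] at e1 e2
        simp only [Prod.mk_eq_zero, Prod.mk.injEq, ne_eq] at ha ⊢
        -- in all cases, `w = t a`
        obtain ⟨t, rfl, rfl⟩ : ∃ t, x = t * a ∧ y = t * b := by
          by_cases h : a = 0
          · have hb : b ≠ 0 := fun hb => ha ⟨h, hb⟩
            refine ⟨y / b, ?_, by field_simp⟩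
            subst h
            have : x = 0 := by simpa [hb] using e2
            simp [this]
          · refine ⟨x / a, by field_simp, ?_⟩
            field_simp
            linear_combination e2 - x * b * h2
        suffices ht : s t = t by
          rcases hfix t ht with rfl | rfl <;> simp
        by_contra hne
        have hu : s t + t ≠ 0 := by
          intro h; apply hne; linear_combination h - t * h2
        simp only [map_mul] at e1
        have e3 : s (s a) * s (s (s a)) * s (s (s t + t)) + β * (s b * b) * (s t + t) = 0 := by
          simp only [map_add]
          linear_combination e1
        have ssu := s0 _ (s0 _ hu)
        by_cases hb : b = 0
        · subst hb
          have ha' : a ≠ 0 := fun h => ha ⟨h, rfl⟩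
          simp [s0 _ (s0 _ ha'), s0 _ (s0 _ (s0 _ ha'))] at e3
          apply hu
          apply sinj; apply sinj; simpa using e3
        · generalize s t + t = u at *
          apply hP (s (s a) * s u / (u * b))
          have := s0 _ hu
          have := s0 _ hb
          simp only [map_mul, map_div₀]
          field_simp
          linear_combination e3 - β * (s b * b) * u * h2
      · rintro (rfl | rfl)
        · exact hz
        · rw [← hz]
          have : z + a + a = z := by
            rw [add_assoc, CharTwo.add_self_eq_zero, add_zero]
          rw [this, add_comm]
    rw [hpair]
    apply Set.ncard_pair
    intro h
    apply ha
    simpa using h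
  · rintro ⟨c, rfl⟩ hA
    have hc0 : c ≠ 0 := by rintro rfl; simp at hβ
    obtain ⟨t, ht0, ht1⟩ : ∃ t : GaloisField 2 m, t ≠ 0 ∧ t ≠ 1 := by
      by_contra h
      push Not at h
      have hsub : (Set.univ : Set (GaloisField 2 m)) ⊆ {0, 1} := by
        intro x _
        by_cases hx : x = 0
        · simp [hx]
        · simp [h x hx]
      have h1 := Set.ncard_le_ncard hsub
      rw [Set.ncard_univ, GaloisField.card 2 m (by omega), Set.ncard_pair zero_ne_one] at h1
      have : 2 ^ 2 ≤ 2 ^ m := Nat.pow_le_pow_right (by norm_num) hm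
      omega
    have hu : s t + t ≠ 0 := by
      intro h
      rcases hfix t (by linear_combination h - t * h2) with h | h
      · exact ht0 h
      · exact ht1 h
    have hsu := s0 _ hu
    obtain ⟨b, hb⟩ : ∃ b, b = s (s t + t) / ((s t + t) * c) := ⟨_, rfl⟩
    have hsc := s0 _ hc0
    have hsub : ({0, (1, b), (t, t * b)} : Set (GaloisField 2 m × GaloisField 2 m)) ⊆
        {x | F (x + (1, b)) + F x = F (1, b)} := by
      have hbb : s c * c * (s b * b) * (s t + t) = s (s (s t + t)) := by
        rw [hb]
        simp only [map_div₀, map_mul]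
        field_simp
      simp only [map_add] at hbb
      rintro x (rfl | rfl | rfl)
      · simp [hF]
      · simp [hF, CharTwo.add_self_eq_zero]
      · simp only [Set.mem_setOf_eq, hF, Prod.ext_iff, Prod.fst_add, Prod.snd_add, map_add,
          map_mul, map_one]
        constructor
        · linear_combination hbb + (s (s t) * s (s (s t)) + s (s t) + s (s (s t))
            + s c * c * (s t * s b * t * b)) * h2
        · linear_combination (t * t * b + t * b) * h2
    have h1 := Set.ncard_le_ncard hsub
    have h3 : ({0, (1, b), (t, t * b)} : Set (GaloisField 2 m × GaloisField 2 m)).ncard = 3 := by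
      rw [Set.ncard_eq_three]
      refine ⟨_, _, _, ?_, ?_, ?_, rfl⟩
      · simp [Prod.ext_iff]
      · simp [Prod.ext_iff, Ne.symm ht0]
      · simp [Prod.ext_iff, Ne.symm ht1]
    have := hA (1, b) (by simp [Prod.ext_iff]) (F (1, b))
    omega
end

section
/- Let m ≥ 4 be an even integer and let β, β' ∈ F_{2^m}^* be non-cubes. (a) For any k with 0 < k < m and gcd(k,m) = 1, the Taniguchi APN functions f_{k,0,β} and f_{m-k,0,β} on F_{2^m} × F_{2^m} are CCZ-equivalent. (b) For integers k, ℓ with 0 < k, ℓ < m/2 and gcd(k,m) = gcd(ℓ,m) = 1, the Taniguchi APN functions f_{k,0,β} and f_{ℓ,0,β'} are CCZ-equivalent if and only if k = ℓ. -/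
/-- Two functions `f, g` on a finite-dimensional `F_2`-vector space `V` are CCZ-equivalent
if some affine permutation of `V × V` (an `F_2`-linear bijection composed with a
translation) maps the graph of `f` onto the graph of `g`. -/
def CCZEquivalent {V : Type*} [AddCommGroup V] [Module (ZMod 2) V] (f g : V → V) : Prop :=
  ∃ (A : V × V → V × V) (c : V × V), IsLinearMap (ZMod 2) A ∧ Function.Bijective A ∧
    (fun p => A p + c) '' {p : V × V | p.2 = f p.1} = {p : V × V | p.2 = g p.1}


namespace Tani

/-- functions of the form (additive) + (additive of `f`) + constant -/
def affSpan {V : Type*} [AddCommGroup V] (f : V → V) : Set (V → V) :=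
  {h | ∃ (P Q : V →+ V) (c : V), ∀ x, h x = P x + Q (f x) + c}

/-- quadratic with polarization `B`, and APN -/
structure QuadAPN {V : Type*} [AddCommGroup V] (f : V → V) (B : V →+ V →+ V) : Prop where
  quad : ∀ x y, f (x + y) = f x + f y + B x y
  apn : ∀ x y, x ≠ 0 → B x y = 0 → y = 0 ∨ y = x

theorem key {V : Type*} [AddCommGroup V] [Fintype V] (h2 : ∀ x : V, x + x = 0)
    (hcard : 8 < Fintype.card V)
    (f g : V → V) (B B' : V →+ V →+ V) (hf : QuadAPN f B) (hg : QuadAPN g B')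
    (b : Equiv.Perm V) (hM : ∀ h : V → V, h ∈ affSpan g ↔ h ∘ b ∈ affSpan f)
    (e : V → V → V) (he : ∀ r x, e r x = b.symm (b x + b r + b 0))
    (h1 : ∀ r v, ∃ v', ∀ x, e r (x + v) = e r x + v')
    (h3 : ∀ r v, ∃ r', ∀ x, e r (x + v) + v = e r' x) :
    ∀ r x, e r x = r + x := by
  have hneg : ∀ x : V, -x = x := fun x => neg_eq_of_add_eq_zero_left (h2 x)
  have hadd0 : ∀ x y : V, x + y = 0 → x = y := fun x y h => by
    have := eq_neg_of_add_eq_zero_left h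
    rwa [hneg] at this
  have hbe : ∀ r x, b (e r x) = b x + b r + b 0 := fun r x => by simp [he]
  have e0 : ∀ r, e r 0 = r := fun r => by
    apply b.injective; rw [hbe]
    have := h2 (b 0)
    grind
  have esymm : ∀ r x, e r x = e x r := fun r x => by
    apply b.injective; rw [hbe, hbe]; abel
  have eself : ∀ r, e r r = 0 := fun r => by
    apply b.injective; rw [hbe, h2, zero_add]
  have ecomp : ∀ r s x, e r (e s x) = e (e r s) x := fun r s x => by
    apply b.injective; simp only [hbe]; abel
  have eaff : ∀ r x v, e r (x + v) = e r x + e r v + r := by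
    intro r x v
    obtain ⟨v', hv'⟩ := h1 r v
    have := hv' 0
    rw [zero_add, e0] at this
    rw [hv', this]
    have := h2 r
    grind
  -- the deviation
  let d : V → V → V := fun r s => e r s + r + s
  have hed : ∀ r s, e r s = r + s + d r s := by
    intro r s
    have := h2 r; have := h2 s
    simp only [d]; grind
  have dadd : ∀ r s t, d r (s + t) = d r s + d r t := by
    intro r s t
    simp only [d, eaff]
    have := h2 r
    grind
  have dsymm : ∀ r s, d r s = d s r := by
    intro r s
    simp only [d]; rw [esymm r s]; abel
  have dself : ∀ r, d r r = 0 := by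
    intro r
    simp only [d]; rw [eself]; simp [h2]
  have dadd' : ∀ r s t, d (r + s) t = d r t + d s t := by
    intro r s t
    rw [dsymm, dadd, dsymm t r, dsymm t s]
  have d0 : ∀ r, d r 0 = 0 := by
    intro r; have := dadd r 0 0; simpa using this
  have dd : ∀ r v s, d (d r v) s = 0 := by
    intro r v s
    obtain ⟨r', hr'⟩ := h3 r v
    have a0 := hr' 0
    have as := hr' s
    rw [zero_add, e0] at a0
    rw [← a0] at as
    rw [eaff] at as
    have : e r v + v = r + d r v := by
      rw [hed]; have := h2 v; grind
    rw [this] at as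
    rw [hed (r + d r v) s, dadd', hed r s, hed r v] at as
    have := h2 r; have := h2 v
    grind
  -- invariance
  have Bself : ∀ x, B x x = 0 := by
    intro x
    have h := hf.quad x x
    have h' := hf.quad 0 0
    rw [h2] at h
    simp only [add_zero, map_zero] at h'
    have := h2 (f x); have := h2 (f 0)
    grind
  have Bsymm : ∀ x y, B x y = B y x := by
    intro x y
    have h := hf.quad x y
    have h' := hf.quad y x
    rw [add_comm y x, h] at h'
    grind
  have f0 : f 0 = 0 := by
    have h' := hf.quad 0 0
    simp only [add_zero, map_zero] at h'
    have := h2 (f 0); grind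
  have hbb : ∀ h : V → V, h ∈ affSpan f → h ∘ b.symm ∈ affSpan g := by
    intro h hh
    rw [hM]
    convert hh using 1
    ext x; simp
  have inv : ∀ r, ∀ h : V → V, h ∈ affSpan f → h ∘ e r ∈ affSpan f := by
    intro r h hh
    obtain ⟨P, Q, c, hPQ⟩ := hbb h hh
    have key : (fun y => (h ∘ b.symm) (y + (b r + b 0))) ∈ affSpan g := by
      refine ⟨P + Q.comp (B'.flip (b r + b 0)), Q,
        P (b r + b 0) + Q (g (b r + b 0)) + c, fun x => ?_⟩
      show (h ∘ b.symm) (x + (b r + b 0)) = _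
      rw [hPQ, hg.quad]
      simp only [map_add, AddMonoidHom.add_apply, AddMonoidHom.comp_apply,
        AddMonoidHom.flip_apply]
      abel
    rw [hM] at key
    convert key using 1
    ext x
    simp [he, add_assoc]
  have dconst : ∀ r s, ∀ h : V → V, h ∈ affSpan f → ∀ x,
      h (e r (e s x)) + h (e r x) + h (e s x) + h x = h (e r s) + h r + h s + h 0 := by
    intro r s h hh
    obtain ⟨P, Q, c, hPQ⟩ := hbb h hh
    have hh' : ∀ x, h x = P (b x) + Q (g (b x)) + c := by
      intro x; have := hPQ (b x); simpa using this
    have gen : ∀ x, h (e r (e s x)) + h (e r x) + h (e s x) + h x = Q (B' (b s + b 0) (b r + b 0)) := by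
      intro x
      simp only [hh', hbe]
      have E1 : b x + b s + b 0 + b r + b 0 = b x + ((b s + b 0) + (b r + b 0)) := by abel
      rw [E1, add_assoc (b x), add_assoc (b x), hg.quad (b x), hg.quad (b x), hg.quad (b x),
        hg.quad (b s + b 0) (b r + b 0)]
      generalize b s + b 0 = u
      generalize b r + b 0 = v
      simp only [map_add]
      have a1 := h2 (P (b x)); have a2 := h2 (P u); have a3 := h2 (P v)
      have a4 := h2 (Q (g (b x))); have a5 := h2 (Q (g u)); have a6 := h2 (Q (g v))
      have a7 := h2 c; have a8 := h2 (Q (B' (b x) u)); have a9 := h2 (Q (B' (b x) v))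
      grind
    intro x
    rw [gen x, ← gen 0]
    simp [e0]
  -- elements of the radical commute
  have Bd : ∀ x, (∀ s, d x s = 0) → ∀ r s, B x (d r s) = 0 := by
    intro x hx r s
    have hfm : f ∈ affSpan f := ⟨0, AddMonoidHom.id V, 0, fun x => by simp⟩
    have h := dconst x r f hfm s
    simp only [hed x, hx, add_zero] at h
    rw [hf.quad x (e r s), hf.quad x s, hf.quad x r, f0, hed r s] at h
    simp only [map_add] at h
    have a1 := h2 (f x); have a2 := h2 (f s); have a3 := h2 (f r)
    have a4 := h2 (f (r + s + d r s)); have a5 := h2 (B x s); have a6 := h2 (B x r)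
    grind
  by_contra hcon
  push Not at hcon
  obtain ⟨p, q, hpq⟩ := hcon
  have hx0 : d p q ≠ 0 := by
    intro h; apply hpq; rw [hed, h, add_zero]
  obtain ⟨x0, hx0def⟩ : ∃ x0, x0 = d p q := ⟨_, rfl⟩
  rw [← hx0def] at hx0
  have hx0R : ∀ s, d x0 s = 0 := by intro s; rw [hx0def, dd]
  have hdv : ∀ r s, d r s = 0 ∨ d r s = x0 := fun r s => hf.apn _ _ hx0 (Bd x0 hx0R r s)
  -- quadratic identity
  have hfm : f ∈ affSpan f := ⟨0, AddMonoidHom.id V, 0, fun x => by simp⟩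
  obtain ⟨P, Q, c, hPQ⟩ := inv p f hfm
  have h1' : ∀ s, f (p + s + d p s) = P s + Q (f s) + c := by
    intro s; have := hPQ s; simpa [hed] using this
  have pol : ∀ s s', d p s' = 0 → B (d p s) s' = Q (B s s') + B s s' := by
    intro s s' hs'
    have b0 := h1' 0
    have b1 := h1' s
    have b2 := h1' s'
    have b3 := h1' (s + s')
    rw [dadd, hs'] at b3
    rw [hs'] at b2
    rw [d0] at b0
    simp only [add_zero, f0, map_zero, zero_add] at b0 b2 b3
    have E1 : p + (s + s') + d p s = (p + s + d p s) + s' := by abel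
    rw [E1, hf.quad _ s', hf.quad s s', b1] at b3
    rw [hf.quad p s', b0] at b2
    simp only [map_add, AddMonoidHom.add_apply] at b3
    rw [Bsymm p s'] at b3 b2
    have a1 := h2 (B s s'); have a2 := h2 c; have a3 := h2 (B s' p); have a4 := h2 (f s')
    grind
  let Q' : V →+ V := Q + AddMonoidHom.id V
  let D : V →+ V := AddMonoidHom.mk' (d p) (dadd p)
  have pol' : ∀ s s', d p s' = 0 → B (d p s) s' = Q' (B s s') := pol
  have hker : ∀ s, Q' (B x0 s) = 0 := by
    intro s
    rw [Bsymm, ← pol' s x0 (by rw [dsymm]; exact hx0R p), Bsymm]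
    exact Bd x0 hx0R p s
  have hK : ∀ s', d p s' = 0 → B x0 s' = Q' (B q s') := by
    intro s' hs'
    rw [← pol' q s' hs', hx0def]
  have two : ∀ (A : AddSubgroup V), (∀ y ∈ A, y = 0 ∨ y = x0) → Nat.card A ≤ 2 := by
    intro A hA
    have : (A : Set V) ⊆ ({0, x0} : Set V) := by
      intro y hy; rcases hA y hy with h | h <;> simp [h]
    have h := Set.ncard_le_ncard this (Set.toFinite _)
    have h' := Set.ncard_pair (Ne.symm hx0)
    rw [h'] at h
    exact h
  have c1 : Nat.card D.range ≤ 2 := by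
    apply two
    rintro y ⟨s, rfl⟩
    exact hdv p s
  have c2 : Nat.card (B x0).ker ≤ 2 := by
    apply two
    intro y hy
    exact hf.apn x0 y hx0 hy
  have e1 := D.ker.card_mul_index
  have e2 := (B x0).ker.card_mul_index
  have e3 := Q'.ker.card_mul_index
  rw [AddSubgroup.index_ker] at e1 e2 e3
  have c3 : Nat.card (B x0).range ≤ Nat.card Q'.ker := by
    apply AddSubgroup.card_le_of_le
    rintro y ⟨s, rfl⟩
    exact hker s
  let C : D.ker →+ V := (B x0).comp D.ker.subtype
  have e4 := C.ker.card_mul_index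
  rw [AddSubgroup.index_ker] at e4
  have c4 : Nat.card C.range ≤ Nat.card Q'.range := by
    apply AddSubgroup.card_le_of_le
    rintro y ⟨s, rfl⟩
    exact ⟨B q s, (hK s s.2).symm⟩
  have c5 : Nat.card C.ker ≤ Nat.card (B x0).ker := by
    let F : C.ker → (B x0).ker := fun z => ⟨z.1.1, z.2⟩
    apply Nat.card_le_card_of_injective F
    intro z w h
    have : z.1.1 = w.1.1 := Subtype.mk.inj h
    exact Subtype.ext (Subtype.ext this)
  rw [Nat.card_eq_fintype_card (α := V)] at e1 e2 e3
  have hpos : 0 < Nat.card (B x0).range := Nat.card_pos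
  have c6 : Nat.card Q'.range ≤ 2 := by
    by_contra hlt
    push Not at hlt
    nlinarith
  nlinarith

end Tani

namespace Tani
open Subgroup

/-- conjugate subgroup `g K g⁻¹` -/
abbrev cj {G : Type*} [Group G] (g : G) (K : Subgroup G) : Subgroup G :=
  K.map (MulAut.conj g).toMonoidHom

theorem cj_cj {G : Type*} [Group G] (g h : G) (K : Subgroup G) :
    cj g (cj h K) = cj (g * h) K := by
  ext x
  simp only [cj, Subgroup.map_map, Subgroup.mem_map]
  constructor
  · rintro ⟨y, hy, rfl⟩
    exact ⟨y, hy, by simp [mul_assoc]⟩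
  · rintro ⟨y, hy, rfl⟩
    exact ⟨y, hy, by simp [mul_assoc]⟩

theorem cj_one {G : Type*} [Group G] (K : Subgroup G) : cj 1 K = K := by
  ext x; simp [cj]

theorem mem_norm {G : Type*} [Group G] (g : G) (K : Subgroup G) :
    g ∈ normalizer (K : Set G) ↔ cj g K = K := by
  exact mem_normalizer_iff_map_conj_eq

theorem nilp {P : Type*} [Group P] (hn : NormalizerCondition P) (F : Subgroup P → Prop)
    (hconj : ∀ K g, F K → F (cj g K))
    (hmut : ∀ K L, F K → F L → (∀ x ∈ K, cj x L = L) → (∀ x ∈ L, cj x K = K) → K = L) :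
    ∀ K L, F K → F L → K = L := by
  have hnorm : ∀ K, F K → ∀ x, cj x K = K := by
    intro K hK
    by_contra hcon
    push Not at hcon
    obtain ⟨x, hx⟩ := hcon
    have hlt : normalizer (K : Set P) < ⊤ := by
      rw [lt_top_iff_ne_top]
      intro h
      apply hx
      rw [← mem_norm, h]; trivial
    obtain ⟨γ, hγ, hγ'⟩ := SetLike.exists_of_lt (hn _ hlt)
    rw [mem_norm] at hγ hγ'
    apply hγ'
    symm
    apply hmut K (cj γ K) hK (hconj _ _ hK)
    · intro k hk
      have h1 : k ∈ cj γ (normalizer (K : Set P)) := by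
        rw [hγ]; exact le_normalizer hk
      obtain ⟨y, hy, rfl⟩ := h1
      have hy' := (mem_norm y K).1 hy
      rw [cj_cj]
      conv_rhs => rw [← hy', cj_cj]
      simp
    · rintro _ ⟨k, hk, rfl⟩
      rw [← mem_norm, ← hγ]
      exact ⟨k, le_normalizer hk, rfl⟩
  intro K L hK hL
  exact hmut K L hK hL (fun x _ => hnorm L hL x) (fun x _ => hnorm K hK x)

theorem map_cj {G H : Type*} [Group G] [Group H] (φ : G →* H) (g : G) (K : Subgroup G) :
    (cj g K).map φ = cj (φ g) (K.map φ) := by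
  ext x
  simp only [cj, Subgroup.map_map, Subgroup.mem_map]
  constructor
  · rintro ⟨y, hy, rfl⟩
    exact ⟨y, hy, by simp⟩
  · rintro ⟨y, hy, rfl⟩
    exact ⟨y, hy, by simp⟩

theorem conj_of {G : Type*} [Group G] [Finite G] (p : ℕ) [Fact p.Prime] (F : Subgroup G → Prop)
    (hp : ∀ K, F K → IsPGroup p K)
    (hconj : ∀ K g, F K → F (cj g K))
    (hmut : ∀ K L, F K → F L → (∀ x ∈ K, cj x L = L) → (∀ x ∈ L, cj x K = K) → K = L) :
    ∀ K L, F K → F L → ∃ g, cj g K = L := by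
  intro K L hK hL
  obtain ⟨P, hP⟩ := (hp K hK).exists_le_sylow
  obtain ⟨P', hP'⟩ := (hp L hL).exists_le_sylow
  obtain ⟨g, hg⟩ := MulAction.exists_smul_eq G P P'
  refine ⟨g, ?_⟩
  have hsub : cj g K ≤ P' := by
    rw [← hg]
    rintro _ ⟨k, hk, rfl⟩
    rw [Sylow.coe_subgroup_smul]
    exact Subgroup.smul_mem_pointwise_smul _ _ _ (hP hk)
  have hnil : Group.IsNilpotent P' := P'.isPGroup'.isNilpotent
  have hn : NormalizerCondition P' := Group.normalizerCondition_of_isNilpotent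
  have inj : Function.Injective (Subgroup.map (P' : Subgroup G).subtype) :=
    Subgroup.map_injective (Subgroup.subtype_injective _)
  have := nilp hn (fun A => F (A.map (P' : Subgroup G).subtype))
    (fun A x hA => by
      show F _
      rw [map_cj]; exact hconj _ _ hA)
    (fun A B hA hB h1 h2 => by
      apply inj
      apply hmut _ _ hA hB
      · rintro _ ⟨x, hx, rfl⟩
        rw [← map_cj, h1 x hx]
      · rintro _ ⟨x, hx, rfl⟩
        rw [← map_cj, h2 x hx])
    ((cj g K).subgroupOf P') (L.subgroupOf P')
    (by
      show F _
      rw [Subgroup.map_subgroupOf_eq_of_le hsub]; exact hconj _ _ hK)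
    (by
      show F _
      rw [Subgroup.map_subgroupOf_eq_of_le hP']; exact hL)
  have h := congrArg (Subgroup.map (P' : Subgroup G).subtype) this
  rwa [Subgroup.map_subgroupOf_eq_of_le hsub, Subgroup.map_subgroupOf_eq_of_le hP'] at h

end Tani
namespace Tani

/-- permutations preserving the affine span -/
def autG {V : Type*} [AddCommGroup V] (f : V → V) : Subgroup (Equiv.Perm V) where
  carrier := {π | ∀ h : V → V, h ∈ affSpan f ↔ h ∘ π ∈ affSpan f}
  one_mem' := fun h => Iff.rfl
  mul_mem' := by
    intro a b ha hb h
    rw [ha h, hb (h ∘ a)]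
    rfl
  inv_mem' := by
    intro a ha h
    rw [ha (h ∘ ⇑a⁻¹)]
    have : (h ∘ ⇑a⁻¹) ∘ a = h := by ext x; simp
    rw [this]

/-- translations -/
def trG (V : Type*) [AddCommGroup V] : Subgroup (Equiv.Perm V) where
  carrier := {π | ∃ v, ∀ x, π x = x + v}
  one_mem' := ⟨0, fun x => by simp⟩
  mul_mem' := by
    rintro a b ⟨v, hv⟩ ⟨w, hw⟩
    exact ⟨w + v, fun x => by simp [hv, hw, add_assoc]⟩
  inv_mem' := by
    rintro a ⟨v, hv⟩
    exact ⟨-v, fun x => by rw [Equiv.Perm.inv_eq_iff_eq, hv]; abel⟩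

theorem mut_eq {V : Type*} [AddCommGroup V] [Fintype V] (h2 : ∀ x : V, x + x = 0)
    (hcard : 8 < Fintype.card V)
    (f g : V → V) (B B' : V →+ V →+ V) (hf : QuadAPN f B) (hg : QuadAPN g B')
    (b : Equiv.Perm V) (hM : ∀ h : V → V, h ∈ affSpan g ↔ h ∘ b ∈ affSpan f)
    (hA : ∀ t ∈ trG V, cj t (cj b⁻¹ (trG V)) = cj b⁻¹ (trG V))
    (hB : ∀ t ∈ cj b⁻¹ (trG V), cj t (trG V) = trG V) :
    cj b⁻¹ (trG V) = trG V := by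
  let tr : V → Equiv.Perm V := fun v => Equiv.addRight v
  have htr : ∀ v, tr v ∈ trG V := fun v => ⟨v, fun x => rfl⟩
  let e : V → Equiv.Perm V := fun r => b⁻¹ * tr (b r + b 0) * b
  have he : ∀ r x, e r x = b.symm (b x + b r + b 0) := by
    intro r x
    simp only [e, tr, Equiv.Perm.mul_apply, Equiv.coe_addRight, add_assoc]
    rfl
  have heT : ∀ r, e r ∈ cj b⁻¹ (trG V) := by
    intro r
    exact ⟨tr (b r + b 0), htr _, by simp [e]⟩
  have hTe : ∀ t ∈ cj b⁻¹ (trG V), ∃ r, t = e r := by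
    rintro _ ⟨t, ⟨u, hu⟩, rfl⟩
    refine ⟨b.symm (u + b 0), ?_⟩
    ext x
    rw [he]
    simp only [MulEquiv.coe_toMonoidHom, MulAut.conj_apply, inv_inv, Equiv.Perm.mul_apply, hu,
      Equiv.apply_symm_apply]
    have : b x + (u + b 0) + b 0 = b x + u := by
      have := h2 (b 0); grind
    rw [this]; rfl
  have main := key h2 hcard f g B B' hf hg b hM (fun r x => e r x) he
    (by
      intro r v
      have h := hB (e r) (heT r)
      have h' : (e r) * tr v * (e r)⁻¹ ∈ trG V := by
        rw [← h]; exact ⟨tr v, htr v, by simp⟩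
      obtain ⟨v', hv'⟩ := h'
      refine ⟨v', fun x => ?_⟩
      have := hv' (e r x)
      simpa [tr] using this)
    (by
      intro r v
      have h := hA (tr v) (htr v)
      have h' : tr v * e r * (tr v)⁻¹ ∈ cj b⁻¹ (trG V) := by
        rw [← h]; exact ⟨e r, heT r, by simp⟩
      obtain ⟨r', hr'⟩ := hTe _ h'
      refine ⟨r', fun x => ?_⟩
      rw [← hr']
      have : (tr v)⁻¹ x = x + v := by
        rw [Equiv.Perm.inv_eq_iff_eq]
        simp [tr, add_assoc, h2]
      simp only [Equiv.Perm.mul_apply, this]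
      rfl)
  apply le_antisymm
  · intro t ht
    obtain ⟨r, rfl⟩ := hTe t ht
    exact ⟨r, fun x => by rw [main]; abel⟩
  · rintro t ⟨v, hv⟩
    have : t = e v := by
      ext x
      have hm : e v x = v + x := main v x
      rw [hv, hm]; abel
    rw [this]; exact heT v

theorem ccz_ea {V : Type*} [AddCommGroup V] [Fintype V] (h2 : ∀ x : V, x + x = 0)
    (hcard : 8 < Fintype.card V)
    (f g : V → V) (B B' : V →+ V →+ V) (hf : QuadAPN f B) (hg : QuadAPN g B')
    (b : Equiv.Perm V) (hM : ∀ h : V → V, h ∈ affSpan g ↔ h ∘ b ∈ affSpan f) :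
    ∃ (a Q : V →+ V), Function.Bijective a ∧ ∀ x y, B' (a x) (a y) = Q (B x y) := by
  classical
  have self_mem : ∀ f : V → V, f ∈ affSpan f :=
    fun f => ⟨0, AddMonoidHom.id V, 0, fun x => by simp⟩
  have quad_trans : ∀ (f g : V → V) (B B' : V →+ V →+ V), QuadAPN f B → QuadAPN g B' →
    ∀ b : Equiv.Perm V, (∀ h : V → V, h ∈ affSpan g ↔ h ∘ b ∈ affSpan f) →
      cj b⁻¹ (trG V) ≤ autG f := by
    rintro f g B B' hf hg b hM _ ⟨t, ⟨u, hu⟩, rfl⟩ 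
    have tinv : ∀ (u : V) (h : V → V), h ∈ affSpan g → (fun x => h (x + u)) ∈ affSpan g := by
      rintro u h ⟨P, Q, c, hPQ⟩
      refine ⟨P + Q.comp (B'.flip u), Q, P u + Q (g u) + c, fun x => ?_⟩
      show h (x + u) = _
      rw [hPQ, hg.quad]
      simp only [map_add, AddMonoidHom.add_apply, AddMonoidHom.comp_apply,
        AddMonoidHom.flip_apply]
      abel
    intro h
    have e1 : h ∈ affSpan f ↔ h ∘ b.symm ∈ affSpan g := by
      rw [hM]
      have : (h ∘ b.symm) ∘ b = h := by ext x; simp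
      rw [this]
    have e2 : h ∘ ⇑((MulAut.conj b⁻¹).toMonoidHom t) ∈ affSpan f ↔
        (fun x => (h ∘ b.symm) (x + u)) ∈ affSpan g := by
      rw [hM]
      have : h ∘ ⇑((MulAut.conj b⁻¹).toMonoidHom t) = (fun x => (h ∘ b.symm) (x + u)) ∘ b := by
        ext x
        simp only [MulEquiv.coe_toMonoidHom, MulAut.conj_apply, inv_inv, Function.comp,
          Equiv.Perm.mul_apply, hu]
        rfl
      rw [this]
    rw [e1, e2]
    constructor
    · exact tinv u _
    · intro h'
      have := tinv u _ h'
      simp only [Function.comp, add_assoc, h2, add_zero] at this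
      exact this
  let H := autG f
  let F : Subgroup H → Prop := fun K => ∃ (g : V → V) (B' : V →+ V →+ V) (b : Equiv.Perm V),
    QuadAPN g B' ∧ (∀ h : V → V, h ∈ affSpan g ↔ h ∘ b ∈ affSpan f) ∧
      K.map H.subtype = cj b⁻¹ (trG V)
  have inj : Function.Injective (Subgroup.map H.subtype) :=
    Subgroup.map_injective (Subgroup.subtype_injective _)
  have mk : ∀ (g : V → V) (B' : V →+ V →+ V) (b : Equiv.Perm V),
    QuadAPN g B' → (∀ h : V → V, h ∈ affSpan g ↔ h ∘ b ∈ affSpan f) →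
      F ((cj b⁻¹ (trG V)).subgroupOf H) ∧
      ((cj b⁻¹ (trG V)).subgroupOf H).map H.subtype = cj b⁻¹ (trG V) := by
    intro g B' b hg hM
    have := Subgroup.map_subgroupOf_eq_of_le (quad_trans f g B B' hf hg b hM)
    exact ⟨⟨g, B', b, hg, hM, this⟩, this⟩
  have conj := conj_of 2 F
    (by
      rintro K ⟨g, B', b, hg, hM, hK⟩ x
      refine ⟨1, ?_⟩
      have : (x.1 : Equiv.Perm V) ∈ K.map H.subtype := ⟨x.1, x.2, rfl⟩
      rw [hK] at this
      obtain ⟨t, ⟨u, hu⟩, ht⟩ := this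
      have ht2 : t ^ 2 = 1 := by
        ext y; simp [pow_two, hu, add_assoc, h2]
      apply Subtype.ext; apply Subtype.ext
      have : ((x.1 : Equiv.Perm V)) ^ 2 = 1 := by
        rw [← ht, ← map_pow, ht2, map_one]
      simpa using this)
    (by
      rintro K γ ⟨g, B', b, hg, hM, hK⟩
      refine ⟨g, B', b * (γ.1)⁻¹, hg, ?_, ?_⟩
      · intro h
        rw [hM h]
        exact (autG f).inv_mem γ.2 (h ∘ b)
      · rw [map_cj, hK, cj_cj]; simp)
    (by
      rintro K L ⟨g1, B1, b1, hg1, hM1, hK⟩ ⟨g2, B2, b2, hg2, hM2, hL⟩ hKL hLK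
      apply inj
      rw [hK, hL]
      have := mut_eq h2 hcard g1 g2 B1 B2 hg1 hg2 (b2 * b1⁻¹)
        (by
          intro h
          rw [hM2, hM1]
          have : (h ∘ ⇑(b2 * b1⁻¹)) ∘ b1 = h ∘ b2 := by ext x; simp
          rw [this])
        (by
          intro t ht
          have hx : b1⁻¹ * t * b1 ∈ K.map H.subtype := by
            rw [hK]; exact ⟨t, ht, by simp⟩
          obtain ⟨x, hx, hxt⟩ := hx
          have h := congrArg (Subgroup.map H.subtype) (hKL x hx)
          rw [map_cj, hxt, hL] at h
          have h' := congrArg (cj b1) h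
          simp only [cj_cj] at h' ⊢
          convert h' using 2 <;> group)
        (by
          rintro _ ⟨t, ht, rfl⟩
          have hx : b2⁻¹ * t * b2 ∈ L.map H.subtype := by
            rw [hL]; exact ⟨t, ht, by simp⟩
          obtain ⟨x, hx, hxt⟩ := hx
          have h := congrArg (Subgroup.map H.subtype) (hLK x hx)
          rw [map_cj, hxt, hK] at h
          have h' := congrArg (cj b1) h
          simp only [cj_cj] at h' ⊢
          rw [mul_inv_cancel, cj_one] at h'
          convert h' using 2
          simp [mul_assoc])
      have h' := congrArg (cj b1⁻¹) this
      rw [cj_cj] at h'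
      rw [← h']
      congr 1
      group)
  obtain ⟨F1, m1⟩ := mk f B 1 hf (fun h => Iff.rfl)
  obtain ⟨F2, m2⟩ := mk g B' b hg hM
  obtain ⟨γ, hγ⟩ := conj _ _ F1 F2
  have h := congrArg (Subgroup.map H.subtype) hγ
  rw [map_cj, m1, m2] at h
  have h' := congrArg (cj b) h
  simp only [cj_cj, inv_one, mul_one, mul_inv_cancel, cj_one] at h'
  obtain ⟨a, ha⟩ : ∃ a : Equiv.Perm V, a = b * γ.1 := ⟨_, rfl⟩
  have h'' : cj a (trG V) = trG V := by rw [ha]; exact h'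
  have aff : ∀ v x, a (x + v) = a x + a v - a 0 := by
    intro v
    have hm : a * Equiv.addRight v * a⁻¹ ∈ trG V := by
      rw [← h'']; exact ⟨Equiv.addRight v, ⟨v, fun x => rfl⟩, by simp⟩
    obtain ⟨v', hv'⟩ := hm
    have hh : ∀ x, a (x + v) = a x + v' := by
      intro x
      have := hv' (a x)
      simpa using this
    intro x
    have h0 := hh 0
    rw [zero_add] at h0
    rw [hh, h0]; abel
  have hga : g ∘ a ∈ affSpan f := by
    have h1 := (hM g).1 (self_mem g)
    have h3 := (γ.2 (g ∘ b)).1 h1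
    rw [ha]; exact h3
  obtain ⟨P, Q, c, hPQ⟩ := hga
  refine ⟨AddMonoidHom.mk' (fun x => a x - a 0) (fun x y => ?_), Q, ?_, ?_⟩
  · simp only [aff]; abel
  · rw [← Finite.injective_iff_bijective]
    intro x y hxy
    simp only [AddMonoidHom.mk'_apply] at hxy
    exact a.injective (sub_left_injective hxy)
  · intro x y
    simp only [AddMonoidHom.mk'_apply]
    have q1 := hPQ (x + y)
    have q2 := hPQ x
    have q3 := hPQ y
    have q4 := hPQ 0
    simp only [Function.comp] at q1 q2 q3 q4
    have f0 : f 0 = 0 := by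
      have h' := hf.quad 0 0
      rw [add_zero, B.map_zero, AddMonoidHom.zero_apply, add_zero] at h'
      rw [h2] at h'; exact h'
    rw [hf.quad, P.map_add, Q.map_add, Q.map_add] at q1
    rw [f0, P.map_zero, Q.map_zero] at q4
    have E1 : a (x + y) = (a x - a 0) + ((a y - a 0) + a 0) := by rw [aff]; abel
    have E2 : a x = (a x - a 0) + a 0 := by abel
    have E3 : a y = (a y - a 0) + a 0 := by abel
    rw [E1, hg.quad _ (_ + _), hg.quad _ (a 0), (B' _).map_add] at q1
    rw [E2, hg.quad] at q2
    rw [E3, hg.quad] at q3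
    linear_combination (norm := abel) q1 - q2 - q3 + q4

end Tani
namespace Tani

theorem ccz_b {V : Type*} [AddCommGroup V] [Module (ZMod 2) V] [Fintype V] (f g : V → V)
    (h : CCZEquivalent f g) :
    ∃ b : Equiv.Perm V, ∀ h : V → V, h ∈ affSpan g ↔ h ∘ b ∈ affSpan f := by
  obtain ⟨A, c, hA, hAb, him⟩ := h
  let A' : V × V ≃+ V × V :=
    { Equiv.ofBijective A hAb with map_add' := hA.map_add }
  have hA' : ∀ p, A p = A' p := fun p => rfl
  have h1 : ∀ x, (A' (x, f x) + c).2 = g (A' (x, f x) + c).1 := by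
    intro x
    have : A (x, f x) + c ∈ {p : V × V | p.2 = g p.1} := by
      rw [← him]; exact ⟨(x, f x), rfl, rfl⟩
    exact this
  let b0 : V → V := fun x => (A' (x, f x) + c).1
  have h3 : ∀ x, A' (x, f x) + c = (b0 x, g (b0 x)) := fun x => Prod.ext rfl (h1 x)
  have binj : Function.Injective b0 := by
    intro x y hxy
    have : A' (x, f x) + c = A' (y, f y) + c := by rw [h3, h3, hxy]
    have := A'.injective (add_right_cancel this)
    exact congrArg Prod.fst this
  let b : Equiv.Perm V := Equiv.ofBijective b0 (Finite.injective_iff_bijective.1 binj)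
  refine ⟨b, fun h => ⟨?_, ?_⟩⟩
  · rintro ⟨P, Q, d, hd⟩
    let R : V × V →+ V := (P.coprod Q).comp A'.toAddMonoidHom
    refine ⟨R.comp (AddMonoidHom.inl V V), R.comp (AddMonoidHom.inr V V), P.coprod Q c + d,
      fun x => ?_⟩
    have e1 : R.comp (AddMonoidHom.inl V V) x + R.comp (AddMonoidHom.inr V V) (f x)
        = R (x, f x) := by
      simp only [AddMonoidHom.comp_apply]
      rw [← R.map_add]; simp
    have e2 : P (b0 x) + Q (g (b0 x)) = P.coprod Q (b0 x, g (b0 x)) := rfl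
    rw [e1, ← add_assoc]
    show h (b0 x) = _
    rw [hd, e2, ← h3, map_add]
    rfl
  · rintro ⟨P, Q, d, hd⟩
    let R : V × V →+ V := (P.coprod Q).comp A'.symm.toAddMonoidHom
    refine ⟨R.comp (AddMonoidHom.inl V V), R.comp (AddMonoidHom.inr V V), - R c + d,
      fun y => ?_⟩
    obtain ⟨x, rfl⟩ := b.surjective y
    have e1 : R.comp (AddMonoidHom.inl V V) (b x) + R.comp (AddMonoidHom.inr V V) (g (b x))
        = R (b x, g (b x)) := by
      simp only [AddMonoidHom.comp_apply]
      rw [← R.map_add]; simp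
    have e2 : P x + Q (f x) = P.coprod Q (x, f x) := rfl
    have e3 : (b x, g (b x)) = A' (x, f x) + c := (h3 x).symm
    have e4 : R (A' (x, f x)) = P.coprod Q (x, f x) := by
      show P.coprod Q (A'.symm (A' (x, f x))) = _
      rw [A'.symm_apply_apply]
    rw [e1, e3, map_add, e4, ← e2]
    have := hd x
    simp only [Function.comp] at this
    rw [this]; abel

theorem ccz_of {V : Type*} [AddCommGroup V] [Module (ZMod 2) V] (f g : V → V)
    (L1 L2 : V ≃+ V) (h : ∀ x, g (L1 x) = L2 (f x)) : CCZEquivalent f g := by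
  let A : V × V →+ V × V := L1.toAddMonoidHom.prodMap L2.toAddMonoidHom
  refine ⟨A, 0, (AddMonoidHom.toZModLinearMap 2 A).isLinear, ?_, ?_⟩
  · exact Function.Bijective.prodMap L1.bijective L2.bijective
  · ext ⟨x, y⟩
    constructor
    · rintro ⟨⟨u, v⟩, huv, heq⟩
      have huv' : v = f u := huv
      subst huv'
      have e : (L1 u, L2 (f u)) = (x, y) := by rw [← heq]; simp [A]
      rw [← e]
      exact (h u).symm
    · intro hxy
      have hxy' : y = g x := hxy
      refine ⟨(L1.symm x, f (L1.symm x)), rfl, ?_⟩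
      subst hxy'
      have := h (L1.symm x)
      simp [A, ← this]

end Tani
namespace Tani

theorem par2 {K : Type*} [Field K] {a c a' c' x y : K} (hd : a * c' ≠ a' * c)
    (h1 : x * c = a * y) (h2 : x * c' = a' * y) : x = 0 ∧ y = 0 := by
  have hd' : a * c' - a' * c ≠ 0 := sub_ne_zero.2 hd
  constructor
  · have : x * (a * c' - a' * c) = 0 := by linear_combination a * h2 - a' * h1
    exact (mul_eq_zero.1 this).resolve_right hd'
  · have : y * (a * c' - a' * c) = 0 := by linear_combination c * h2 - c' * h1
    exact (mul_eq_zero.1 this).resolve_right hd'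

theorem par_trans {K : Type*} [Field K] {a c a' c' x y : K} (hd : x ≠ 0 ∨ y ≠ 0)
    (h1 : x * c = a * y) (h2 : x * c' = a' * y) : a * c' = a' * c := by
  rcases hd with hd | hd
  · apply mul_left_cancel₀ hd
    linear_combination a * h2 - a' * h1
  · apply mul_left_cancel₀ hd
    linear_combination - c' * h1 + c * h2

theorem supp {K G : Type*} [Field K] [CommGroup G] (s : G) (s1 : s ≠ 1) (s2 : s * s ≠ 1)
    (s3 : s * s * s ≠ 1) (s4 : s * s * s * s ≠ 1) (a b c d : G → K)
    (H1 : ∀ g h, g ≠ h * s → h ≠ g * s → a g * c h = a h * c g)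
    (H2 : ∀ g h, g ≠ h → a g * d h = b h * c g)
    (N1 : ∃ g, a g ≠ 0 ∨ c g ≠ 0)
    (N2 : ∀ p q, (p ≠ 0 ∨ q ≠ 0) → (∀ g, a g * q = p * c g) → (∀ g, b g * q = p * d g) → False) :
    ∃ j, (a j ≠ 0 ∨ c j ≠ 0) ∧ ∀ h, h ≠ j → h ≠ j * s → h ≠ j * s⁻¹ → a h = 0 ∧ c h = 0 := by
  by_cases hc : ∃ i, a i * c (i * s) ≠ a (i * s) * c i
  · obtain ⟨i, hi⟩ := hc
    have hv : ∀ h, h ≠ i * s⁻¹ → h ≠ i → h ≠ i * s → h ≠ i * s * s → a h = 0 ∧ c h = 0 := by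
      intro h n1 n2 n3 n4
      refine par2 hi (H1 h i n3 ?_) (H1 h (i * s) n4 ?_)
      · intro e; apply n1; rw [e]; simp
      · intro e; exact n2 (mul_right_cancel e).symm
    have hi0 : a i ≠ 0 ∨ c i ≠ 0 := by
      by_contra hh; push Not at hh; apply hi; rw [hh.1, hh.2]; simp
    have hi1 : a (i * s) ≠ 0 ∨ c (i * s) ≠ 0 := by
      by_contra hh; push Not at hh; apply hi; rw [hh.1, hh.2]; simp
    by_cases hu : a (i * s⁻¹) = 0 ∧ c (i * s⁻¹) = 0
    · refine ⟨i * s, hi1, fun h n1 n2 n3 => ?_⟩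
      by_cases e : h = i * s⁻¹
      · rw [e]; exact hu
      · exact hv h e (by simpa using n3) n1 n2
    by_cases hz : a (i * s * s) = 0 ∧ c (i * s * s) = 0
    · refine ⟨i, hi0, fun h n1 n2 n3 => ?_⟩
      by_cases e : h = i * s * s
      · rw [e]; exact hz
      · exact hv h n3 n1 n2 e
    exfalso
    have hu' : a (i * s⁻¹) ≠ 0 ∨ c (i * s⁻¹) ≠ 0 := by tauto
    apply hz
    have k1 : a (i * s⁻¹) * c (i * s) = a (i * s) * c (i * s⁻¹) := by
      apply H1
      · intro e
        apply s3
        rw [mul_assoc, mul_left_cancel_iff, inv_eq_iff_mul_eq_one] at e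
        rw [← e]; group
      · intro e
        rw [inv_mul_cancel_right] at e
        exact s1 (mul_eq_left.1 e)
    have k2 : a (i * s * s) * c i = a i * c (i * s * s) := by
      apply H1
      · intro e; exact s1 (mul_eq_left.1 (mul_right_cancel e))
      · intro e
        apply s3
        rw [mul_assoc, mul_assoc, left_eq_mul] at e
        rw [← e]; group
    have k3 : a (i * s⁻¹) * c (i * s * s) = a (i * s * s) * c (i * s⁻¹) := by
      apply H1
      · intro e
        apply s4
        rw [mul_assoc, mul_assoc, mul_left_cancel_iff, inv_eq_iff_mul_eq_one] at e
        rw [← e]; group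
      · intro e
        rw [inv_mul_cancel_right, mul_assoc] at e
        exact s2 (mul_eq_left.1 e)
    have k4 := par_trans hu' k3 k1
    exact par2 hi k2 k4
  · push Not at hc
    have hall : ∀ g h, a g * c h = a h * c g := by
      intro g h
      by_cases e1 : g = h * s
      · rw [e1, hc h]
      by_cases e2 : h = g * s
      · rw [e2, hc g]
      exact H1 g h e1 e2
    obtain ⟨g0, hg0⟩ := N1
    have : ∃ j, b j * c g0 ≠ a g0 * d j := by
      by_contra hh
      push Not at hh
      exact N2 _ _ hg0 (fun g => hall g g0) hh
    obtain ⟨j, hj⟩ := this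
    have hz : ∀ h, h ≠ j → a h = 0 ∧ c h = 0 := fun h hh =>
      par2 (Ne.symm hj) (hall h g0) (H2 h j hh)
    have : g0 = j := by
      by_contra hh
      have := hz g0 hh
      tauto
    exact ⟨j, this ▸ hg0, fun h h1 _ _ => hz h h1⟩

theorem core {K G : Type*} [Field K] [CommGroup G] [MulSemiringAction G K]
    (s r : G) (s1 : s ≠ 1) (s2 : s * s ≠ 1)
    (s3 : s * s * s ≠ 1) (s4 : s * s * s * s ≠ 1)
    (r1 : r ≠ 1) (r2 : r ≠ s) (r3 : r * s ≠ 1) (r4 : r * r ≠ 1) (r5 : r * r ≠ s)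
    (r6 : r * r * s ≠ 1)
    (a b c d : G → K) (β' : K) (hβ : β' ≠ 0)
    (H1 : ∀ g h, g ≠ h * s → h ≠ g * s → a g * c h = a h * c g)
    (H2 : ∀ g h, g ≠ h → a g * d h = b h * c g)
    (H3 : ∀ g h, g ≠ h * s → h ≠ g * s →
      (r * r) • ((r • a (r⁻¹ * ((r * r)⁻¹ * g))) * a ((r * r)⁻¹ * h)
        + a ((r * r)⁻¹ * g) * (r • a (r⁻¹ * ((r * r)⁻¹ * h))))
      + β' * ((r • c (r⁻¹ * g)) * c h + c g * (r • c (r⁻¹ * h))) = 0)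
    (N1 : ∃ g, a g ≠ 0 ∨ c g ≠ 0)
    (N2 : ∀ p q, (p ≠ 0 ∨ q ≠ 0) → (∀ g, a g * q = p * c g) → (∀ g, b g * q = p * d g) → False) :
    False := by
  obtain ⟨j, hj, hs⟩ := supp s s1 s2 s3 s4 a b c d H1 H2 N1 N2
  have z : ∀ t, t ≠ 1 → t ≠ s → t * s ≠ 1 → a (j * t) = 0 ∧ c (j * t) = 0 := by
    intro t t1 t2 t3
    apply hs
    · simpa using t1
    · simpa using t2
    · intro e
      rw [mul_left_cancel_iff, eq_inv_iff_mul_eq_one] at e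
      exact t3 e
  have zi : ∀ t, t ≠ 1 → t ≠ s → t * s ≠ 1 → a (j * t⁻¹) = 0 ∧ c (j * t⁻¹) = 0 := by
    intro t t1 t2 t3
    apply hs
    · simpa using t1
    · intro e
      rw [mul_left_cancel_iff, inv_eq_iff_mul_eq_one] at e
      exact t3 e
    · simpa using t2
  have cj0 : c j = 0 := by
    have := H3 (j * r) j (by simpa using r2) (by
      intro e; rw [mul_assoc, left_eq_mul] at e; exact r3 e)
    have e1 : r⁻¹ * ((r * r)⁻¹ * (j * r)) = j * (r * r)⁻¹ := by
      rw [mul_comm j, mul_comm j]; group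
    have e2 : (r * r)⁻¹ * (j * r) = j * r⁻¹ := by
      rw [mul_comm j, mul_comm j]; group
    have e3 : r⁻¹ * (j * r) = j := by simp [mul_comm]
    rw [e1, e2, e3, (zi _ r4 r5 r6).1, (zi _ r1 r2 r3).1, (z _ r1 r2 r3).2] at this
    simpa [hβ, smul_eq_zero_iff_eq] using this
  have aj0 : a j = 0 := by
    have := H3 (j * (r * r * r)) (j * (r * r)) (by
      intro e; rw [mul_assoc j, mul_left_cancel_iff, mul_left_cancel_iff] at e; exact r2 e) (by
      intro e; rw [mul_assoc j, mul_left_cancel_iff, mul_assoc (r * r), left_eq_mul] at e; exact r3 e)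
    have e1 : r⁻¹ * ((r * r)⁻¹ * (j * (r * r * r))) = j := by
      rw [mul_comm j]; group
    have e2 : (r * r)⁻¹ * (j * (r * r)) = j := by
      rw [mul_comm j]; group
    have e3 : (r * r)⁻¹ * (j * (r * r * r)) = j * r := by
      rw [mul_comm j, mul_comm j]; group
    have e4 : r⁻¹ * (j * (r * r)) = j * r := by
      rw [mul_comm j, mul_comm j]; group
    rw [e1, e2, e3, e4, (z _ r4 r5 r6).2, (z _ r1 r2 r3).2, (z _ r1 r2 r3).1] at this
    simpa [hβ, smul_eq_zero_iff_eq] using this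
  tauto

end Tani
namespace Tani

/-- characters of the group acting on the field are linearly independent -/
def Ind (K G : Type*) [Field K] [CommGroup G] [Fintype G] [MulSemiringAction G K] : Prop :=
  ∀ c : G → K, (∀ x : K, ∑ g, c g * g • x = 0) → ∀ g, c g = 0

/-- every additive map is a combination of the group elements -/
def Gen (K G : Type*) [Field K] [CommGroup G] [Fintype G] [MulSemiringAction G K] : Prop :=
  ∀ L : K →+ K, ∃ c : G → K, ∀ x : K, L x = ∑ g, c g * g • x

/-- expansion of an additive function -/
def HasL {K G : Type*} [Field K] [CommGroup G] [Fintype G] [MulSemiringAction G K]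
    (F : K → K) (c : G → K) : Prop := ∀ x, F x = ∑ g, c g * g • x

/-- expansion of a biadditive function -/
def HasC {K G : Type*} [Field K] [CommGroup G] [Fintype G] [MulSemiringAction G K]
    (F : K → K → K) (c : G → G → K) : Prop :=
  ∀ x y, F x y = ∑ g, ∑ h, c g h * (g • x * h • y)

section
variable {K G : Type*} [Field K] [CommGroup G] [Fintype G] [MulSemiringAction G K]

theorem HasC.uniq (hi : Ind K G) {F : K → K → K} {c c' : G → G → K} (h : HasC F c)
    (h' : HasC F c') (g k : G) : c g k = c' g k := by
  rw [← sub_eq_zero]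
  refine hi (fun k => c g k - c' g k) (fun y => ?_) k
  refine hi (fun g => ∑ k, (c g k - c' g k) * k • y) (fun x => ?_) g
  have := (h x y).symm.trans (h' x y)
  rw [← sub_eq_zero, ← Finset.sum_sub_distrib] at this
  rw [← this]
  refine Finset.sum_congr rfl fun g _ => ?_
  rw [← Finset.sum_sub_distrib, Finset.sum_mul]
  refine Finset.sum_congr rfl fun k _ => ?_
  ring

theorem HasC.add {F F' : K → K → K} {c c' : G → G → K} (h : HasC F c)
    (h' : HasC F' c') : HasC (fun x y => F x y + F' x y) (fun g k => c g k + c' g k) := by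
  intro x y
  simp only [h x y, h' x y, add_mul, Finset.sum_add_distrib]

theorem HasC.cmul {F : K → K → K} {c : G → G → K} (b : K) (h : HasC F c) :
    HasC (fun x y => b * F x y) (fun g k => b * c g k) := by
  intro x y
  simp only [h x y, Finset.mul_sum, mul_assoc]

theorem HasC.swap {F : K → K → K} {c : G → G → K} (h : HasC F c) :
    HasC (fun x y => F y x) (fun g k => c k g) := by
  intro x y
  simp only [h y x]
  rw [Finset.sum_comm]
  refine Finset.sum_congr rfl fun g _ => Finset.sum_congr rfl fun k _ => ?_
  ring

theorem HasC.smul {F : K → K → K} {c : G → G → K} (t : G) (h : HasC F c) :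
    HasC (fun x y => t • F x y) (fun g k => t • c (t⁻¹ * g) (t⁻¹ * k)) := by
  intro x y
  simp only [h x y, Finset.smul_sum]
  symm
  rw [← Equiv.sum_comp (Equiv.mulLeft t)]
  refine Finset.sum_congr rfl fun g _ => ?_
  rw [← Equiv.sum_comp (Equiv.mulLeft t)]
  refine Finset.sum_congr rfl fun k _ => ?_
  simp [smul_mul', mul_smul]

theorem HasL.smul {F : K → K} {c : G → K} (t : G) (h : HasL F c) :
    HasL (fun x => t • F x) (fun g => t • c (t⁻¹ * g)) := by
  intro x
  simp only [h x, Finset.smul_sum]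
  symm
  rw [← Equiv.sum_comp (Equiv.mulLeft t)]
  refine Finset.sum_congr rfl fun g _ => ?_
  simp [smul_mul', mul_smul]

theorem HasL.mul {F F' : K → K} {c c' : G → K} (h : HasL F c) (h' : HasL F' c') :
    HasC (fun x y => F x * F' y) (fun g k => c g * c' k) := by
  intro x y
  simp only [h x, h' y, Finset.sum_mul_sum]
  refine Finset.sum_congr rfl fun g _ => Finset.sum_congr rfl fun k _ => ?_
  ring

theorem HasL.comp [DecidableEq G] {F : K → K} {c : G → K} (s : G) (h : HasL F c) :
    HasC (fun x y => F (s • x * y)) (fun g k => if g = k * s then c k else 0) := by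
  intro x y
  simp only [h (s • x * y)]
  rw [Finset.sum_comm]
  refine Finset.sum_congr rfl fun g _ => ?_
  simp [ite_mul, smul_mul', mul_smul]

/-- polar form of the Taniguchi function -/
def tb (s : G) (β : K) (p q : K × K) : K × K :=
  ((s * s) • (s • p.1 * q.1 + p.1 * s • q.1) + β * (s • p.2 * q.2 + p.2 * s • q.2),
    p.1 * q.2 + q.1 * p.2)

theorem noneq [CharP K 2] (hi : Ind K G) (hgen : Gen K G)
    (s r : G) (s1 : s ≠ 1) (s2 : s * s ≠ 1)
    (s3 : s * s * s ≠ 1) (s4 : s * s * s * s ≠ 1)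
    (r1 : r ≠ 1) (r2 : r ≠ s) (r3 : r * s ≠ 1) (r4 : r * r ≠ 1) (r5 : r * r ≠ s)
    (r6 : r * r * s ≠ 1) (β β' : K) (hβ : β' ≠ 0) (L Q : K × K →+ K × K)
    (hL : Function.Bijective L) (hLQ : ∀ p q, tb r β' (L p) (L q) = Q (tb s β p q)) : False := by
  classical
  let fst := AddMonoidHom.fst K K
  let snd := AddMonoidHom.snd K K
  let inl := AddMonoidHom.inl K K
  let inr := AddMonoidHom.inr K K
  obtain ⟨a, ha⟩ := hgen (fst.comp (L.comp inl))
  obtain ⟨c, hc⟩ := hgen (snd.comp (L.comp inl))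
  obtain ⟨b, hb⟩ := hgen (fst.comp (L.comp inr))
  obtain ⟨d, hd⟩ := hgen (snd.comp (L.comp inr))
  have ha : HasL (fun x => (L (x, 0)).1) a := ha
  have hc : HasL (fun x => (L (x, 0)).2) c := hc
  have hb : HasL (fun x => (L (0, x)).1) b := hb
  have hd : HasL (fun x => (L (0, x)).2) d := hd
  have hzero : ∀ F : K → K, (HasL F (fun _ : G => 0)) → ∀ x, F x = 0 := by
    intro F h x; rw [h x]; simp
  have comp : ∀ M : K →+ K, ∃ e : G → G → K, HasC (fun x y => M (s • x * y + x * s • y)) e ∧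
      ∀ g h, g ≠ h * s → h ≠ g * s → e g h = 0 := by
    intro M
    obtain ⟨e, he⟩ := hgen M
    have h1 := HasL.comp s (F := M) he
    have h2 := h1.add h1.swap
    refine ⟨_, fun x y => (?_ : _ = _).trans (h2 x y), ?_⟩
    · simp only
      rw [map_add, mul_comm x]
    · intro g h n1 n2
      simp [n1, n2]
  refine core s r s1 s2 s3 s4 r1 r2 r3 r4 r5 r6 a b c d β' hβ ?_ ?_ ?_ ?_ ?_
  · obtain ⟨e, he, he0⟩ := comp (snd.comp (Q.comp (inl.comp
      (DistribSMul.toAddMonoidHom K (s * s)))))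
    have h1 := (ha.mul hc).add (ha.mul hc).swap
    intro g h n1 n2
    have h2 : HasC (fun x y => (L (x, 0)).1 * (L (y, 0)).2 + (L (y, 0)).1 * (L (x, 0)).2) e := by
      intro x y
      rw [← he x y]
      have := congrArg Prod.snd (hLQ (x, 0) (y, 0))
      simp only [tb] at this
      refine this.trans ?_
      simp [fst, snd, inl]
    have := h1.uniq hi h2 g h
    rw [he0 g h n1 n2] at this
    exact CharTwo.add_eq_zero.1 this
  · obtain ⟨e, he⟩ := hgen (snd.comp (Q.comp inr))
    have h0 := HasL.comp 1 (F := snd.comp (Q.comp inr)) he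
    have h1 := (ha.mul hd).add (hb.mul hc).swap
    intro g h n1
    have h2 : HasC (fun x y => (L (x, 0)).1 * (L (0, y)).2 + (L (0, y)).1 * (L (x, 0)).2)
        (fun g k : G => if g = k * 1 then e k else 0) := by
      intro x y
      rw [← h0 x y]
      have := congrArg Prod.snd (hLQ (x, 0) (0, y))
      simp only [tb] at this
      refine this.trans ?_
      simp [snd, inr]
    have := h1.uniq hi h2 g h
    simp only [mul_one, n1, if_false] at this
    exact CharTwo.add_eq_zero.1 this
  · obtain ⟨e, he, he0⟩ := comp (fst.comp (Q.comp (inl.comp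
      (DistribSMul.toAddMonoidHom K (s * s)))))
    have h1 := ((((ha.smul r).mul ha).add (ha.mul (ha.smul r))).smul (r * r)).add
      ((((hc.smul r).mul hc).add (hc.mul (hc.smul r))).cmul β')
    intro g h n1 n2
    rw [← he0 g h n1 n2]
    refine h1.uniq hi ?_ g h
    intro x y
    rw [← he x y]
    have := congrArg Prod.fst (hLQ (x, 0) (y, 0))
    simp only [tb] at this
    refine this.trans ?_
    simp [fst, inl]
  · by_contra hh
    push Not at hh
    have e1 : a = fun _ => 0 := funext fun g => (hh g).1
    have e2 : c = fun _ => 0 := funext fun g => (hh g).2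
    rw [e1] at ha
    rw [e2] at hc
    have : L (1, 0) = L 0 := by
      rw [map_zero]
      exact Prod.ext (hzero _ ha 1) (hzero _ hc 1)
    have := congrArg Prod.fst (hL.1 this)
    exact one_ne_zero this
  · intro p q hpq h1 h2
    have ex : ∀ x, (L (x, 0)).1 * q = p * (L (x, 0)).2 := by
      intro x
      rw [show (L (x, 0)).1 = _ from ha x, show (L (x, 0)).2 = _ from hc x, Finset.sum_mul,
        Finset.mul_sum]
      refine Finset.sum_congr rfl fun g _ => ?_
      linear_combination (g • x) * h1 g
    have ey : ∀ x, (L (0, x)).1 * q = p * (L (0, x)).2 := by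
      intro x
      rw [show (L (0, x)).1 = _ from hb x, show (L (0, x)).2 = _ from hd x, Finset.sum_mul,
        Finset.mul_sum]
      refine Finset.sum_congr rfl fun g _ => ?_
      linear_combination (g • x) * h2 g
    have el : ∀ z, (L z).1 * q = p * (L z).2 := by
      rintro ⟨x, y⟩
      have : ((x, y) : K × K) = (x, 0) + (0, y) := by simp
      rw [this, map_add]
      simp only [Prod.fst_add, Prod.snd_add]
      linear_combination ex x + ey y
    obtain ⟨z1, hz1⟩ := hL.2 (1, 0)
    obtain ⟨z2, hz2⟩ := hL.2 (0, 1)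
    have f1 := el z1
    have f2 := el z2
    rw [hz1] at f1
    rw [hz2] at f2
    simp at f1 f2
    rcases hpq with h | h
    · exact h f2.symm
    · exact h f1

end

end Tani
namespace Tani

theorem setup (K : Type) [Field K] [Finite K] [Algebra (ZMod 2) K] :
    ∃ (G : Type) (_ : CommGroup G) (_ : Fintype G) (_ : MulSemiringAction G K) (φ : G),
      Ind K G ∧ Gen K G ∧ orderOf φ = Module.finrank (ZMod 2) K ∧ ∀ x : K, φ • x = x ^ 2 := by
  classical
  let _ := Fintype.ofFinite K
  haveI : FiniteDimensional (ZMod 2) K := Module.Finite.of_finite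
  let cg : CommGroup Gal(K/ZMod 2) := IsCyclic.commGroup
  let act : MulSemiringAction Gal(K/ZMod 2) K := AlgEquiv.applyMulSemiringAction
  have lin := (linearIndependent_algHom_toLinearMap (ZMod 2) K K).comp _
        (algEquivEquivAlgHom (ZMod 2) K).injective
  refine ⟨Gal(K/ZMod 2), cg, inferInstance, act,
    FiniteField.frobeniusAlgEquivOfAlgebraic (ZMod 2) K, ?_, ?_, ?_, ?_⟩
  · intro c hc
    rw [Fintype.linearIndependent_iff] at lin
    apply lin
    ext x
    simpa using hc x
  · intro L
    have hspan := lin.span_eq_top_of_card_eq_finrank (by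
      rw [Module.finrank_linearMap_self, ← Nat.card_eq_fintype_card,
        IsGalois.card_aut_eq_finrank])
    have hm : (AddMonoidHom.toZModLinearMap 2 L) ∈ (⊤ : Submodule K (K →ₗ[ZMod 2] K)) := trivial
    rw [← hspan, Submodule.mem_span_range_iff_exists_fun] at hm
    obtain ⟨c, hc⟩ := hm
    refine ⟨c, fun x => ?_⟩
    have := congrArg (fun l => l x) hc
    simpa using this.symm
  · exact FiniteField.orderOf_frobeniusAlgEquivOfAlgebraic (ZMod 2) K
  · intro x
    show FiniteField.frobeniusAlgEquivOfAlgebraic (ZMod 2) K x = x ^ 2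
    rw [FiniteField.coe_frobeniusAlgEquivOfAlgebraic]
    simp

end Tani
namespace Tani

section
variable {K G : Type*} [Field K] [CommGroup G] [MulSemiringAction G K]

theorem pow_smul_eq (φ : G) (hφ : ∀ x : K, φ • x = x ^ 2) (k : ℕ) (x : K) :
    φ ^ k • x = x ^ (2 ^ k) := by
  induction k generalizing x with
  | zero => simp
  | succ n ih => rw [pow_succ, mul_smul, hφ, ih, ← pow_mul, pow_succ, mul_comm]

theorem fixed (φ : G) (hφ : ∀ x : K, φ • x = x ^ 2) (k : ℕ) (hk : k.Coprime (orderOf φ)) (t : K)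
    (ht : φ ^ k • t = t) : t = 0 ∨ t = 1 := by
  obtain ⟨n, hn⟩ := exists_pow_eq_self_of_coprime hk
  have h : ∀ n : ℕ, (φ ^ k) ^ n • t = t := by
    intro n
    induction n with
    | zero => simp
    | succ n ih => rw [pow_succ, mul_smul, ht, ih]
  have := h n
  rw [hn, hφ] at this
  have h3 : t * (t - 1) = 0 := by linear_combination this
  rcases mul_eq_zero.1 h3 with h | h
  · exact Or.inl h
  · exact Or.inr (sub_eq_zero.1 h)

theorem cube1 (φ : G) (hφ : ∀ x : K, φ • x = x ^ 2) (k : ℕ) (hk : Odd k) (u : K) :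
    ∃ v, u * φ ^ k • u = v ^ 3 := by
  have : 3 ∣ 2 ^ k + 1 := by
    have := hk.nat_add_dvd_pow_add_pow 2 1
    simpa using this
  obtain ⟨n, hn⟩ := this
  refine ⟨u ^ n, ?_⟩
  rw [pow_smul_eq φ hφ, ← pow_succ', hn, ← pow_mul, mul_comm]

theorem cube2 (φ : G) (hφ : ∀ x : K, φ • x = x ^ 2) (k : ℕ) (u : K) :
    ∃ v, (φ ^ k * φ ^ k) • u = u * v ^ 3 := by
  have : 3 ∣ 4 ^ k - 1 := by
    have := Nat.sub_dvd_pow_sub_pow 4 1 k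
    simpa using this
  obtain ⟨n, hn⟩ := this
  refine ⟨u ^ n, ?_⟩
  rw [← pow_add, pow_smul_eq φ hφ, ← pow_mul, mul_comm n, ← hn, ← pow_succ']
  congr 1
  have : 1 ≤ 4 ^ k := Nat.one_le_pow _ _ (by norm_num)
  rw [Nat.sub_add_cancel this, show 4 = 2 ^ 2 by rfl, ← pow_mul]
  congr 1; ring

theorem tani_eq (φ : G) (hφ : ∀ x : K, φ • x = x ^ 2) (k : ℕ) (β : K) (p : K × K) :
    taniguchi k 0 β p =
      ((φ ^ k * φ ^ k) • (φ ^ k • p.1 * p.1) + β * (φ ^ k • p.2 * p.2), p.1 * p.2) := by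
  rw [← pow_add, pow_smul_eq φ hφ, pow_smul_eq φ hφ, pow_smul_eq φ hφ]
  simp only [taniguchi]
  refine Prod.ext ?_ rfl
  simp only [← pow_succ]
  rw [← pow_mul, two_mul, mul_comm (2 ^ (k + k))]
  ring

/-- polar form as biadditive map -/
def tbH (s : G) (β : K) : K × K →+ K × K →+ K × K :=
  AddMonoidHom.mk' (fun p => AddMonoidHom.mk' (fun q =>
    ((s * s) • (s • p.1 * q.1 + p.1 * s • q.1) + β * (s • p.2 * q.2 + p.2 * s • q.2),
    p.1 * q.2 + q.1 * p.2)) (by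
      intro a b
      ext
      · simp only [Prod.fst_add, Prod.snd_add, smul_add, smul_mul', mul_add]; ring
      · simp only [Prod.fst_add, Prod.snd_add]; ring)) (by
      intro a b
      ext q
      · simp only [Prod.fst_add, Prod.snd_add, smul_add, smul_mul', AddMonoidHom.add_apply,
          AddMonoidHom.mk'_apply]; ring
      · simp only [Prod.fst_add, Prod.snd_add, AddMonoidHom.add_apply,
          AddMonoidHom.mk'_apply]; ring)

theorem tbH_apply (s : G) (β : K) (p q : K × K) : tbH s β p q =
    ((s * s) • (s • p.1 * q.1 + p.1 * s • q.1) + β * (s • p.2 * q.2 + p.2 * s • q.2),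
    p.1 * q.2 + q.1 * p.2) := rfl

theorem tani_apn [CharP K 2] (φ : G) (hφ : ∀ x : K, φ • x = x ^ 2) (k : ℕ) (hko : Odd k)
    (hk : k.Coprime (orderOf φ)) (β : K) (hβ : ∀ x : K, x ^ 3 ≠ β) :
    QuadAPN (taniguchi k 0 β) (tbH (φ ^ k) β) := by
  constructor
  · intro p q
    rw [tani_eq φ hφ, tani_eq φ hφ, tani_eq φ hφ, tbH_apply]
    ext
    · simp only [Prod.fst_add, Prod.snd_add, smul_add, smul_mul', mul_add]; ring
    · simp only [Prod.fst_add, Prod.snd_add]; ring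
  · rintro ⟨x, y⟩ ⟨x', y'⟩ hne h
    rw [tbH_apply] at h
    have h1 := congrArg Prod.fst h
    have h2 := congrArg Prod.snd h
    simp only [Prod.fst_zero, Prod.snd_zero] at h1 h2
    have fin : ∀ t : K, x' = t * x → y' = t * y → (t + φ ^ k • t = 0) →
        ((x', y') : K × K) = 0 ∨ ((x', y') : K × K) = (x, y) := by
      intro t hx hy ht
      rcases fixed φ hφ k hk t (CharTwo.add_eq_zero.1 ht).symm with h | h
      · left; rw [hx, hy, h]; simp
      · right; rw [hx, hy, h]; simp
    by_cases hy : y = 0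
    · have hx : x ≠ 0 := by
        rintro rfl; exact hne (by rw [hy]; rfl)
      subst hy
      have hy' : y' = 0 := by simpa [hx] using h2
      subst hy'
      apply fin (x' / x) (by field_simp) (by simp)
      simp only [smul_zero, mul_zero, add_zero, smul_eq_zero_iff_eq] at h1
      have hsx : φ ^ k • x ≠ 0 := by rwa [Ne, smul_eq_zero_iff_eq]
      rw [smul_div₀']
      field_simp
      linear_combination h1
    · have hx' : x' = (y' / y) * x := by
        field_simp
        have := CharTwo.add_eq_zero.1 h2
        rw [← this]; ring
      have hy' : y' = (y' / y) * y := by field_simp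
      generalize y' / y = t at hx' hy'
      apply fin t hx' hy'
      by_contra hc
      obtain ⟨v, hv⟩ := cube1 φ hφ k hko x
      obtain ⟨w, hw⟩ := cube1 φ hφ k hko y
      obtain ⟨z, hz⟩ := cube2 φ hφ k (t + φ ^ k • t)
      have e1 : φ ^ k • x * x' + x * φ ^ k • x' = v ^ 3 * (t + φ ^ k • t) := by
        rw [← hv, hx', smul_mul']; ring
      have e2 : φ ^ k • y * y' + y * φ ^ k • y' = w ^ 3 * (t + φ ^ k • t) := by
        rw [← hw, hy', smul_mul']; ring
      rw [e1, e2, smul_mul', hz] at h1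
      have h3 := CharTwo.add_eq_zero.1 h1
      have hw0 : w ≠ 0 := by
        rintro rfl
        have : y * φ ^ k • y = 0 := by rw [hw]; simp
        rcases mul_eq_zero.1 this with h | h
        · exact hy h
        · exact hy ((smul_eq_zero_iff_eq _).1 h)
      rw [smul_pow'] at h3
      apply hβ (((φ ^ k * φ ^ k) • v) * z / w)
      generalize t + φ ^ k • t = c at *
      generalize (φ ^ k * φ ^ k) • v = v' at *
      field_simp
      apply mul_left_cancel₀ hc
      linear_combination h3

end

end Tani
namespace Tani

theorem ccz_of' {V : Type*} [AddCommGroup V] [Module (ZMod 2) V] [Finite V] (f g : V → V)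
    (L1 L2 : V → V) (a1 : ∀ x y, L1 (x + y) = L1 x + L1 y) (a2 : ∀ x y, L2 (x + y) = L2 x + L2 y)
    (i1 : ∀ x, L1 x = 0 → x = 0) (i2 : ∀ x, L2 x = 0 → x = 0)
    (h : ∀ x, g (L1 x) = L2 (f x)) : CCZEquivalent f g := by
  let M1 : V →+ V := AddMonoidHom.mk' L1 a1
  let M2 : V →+ V := AddMonoidHom.mk' L2 a2
  have b1 : Function.Injective M1 := (injective_iff_map_eq_zero _).2 i1
  have b2 : Function.Injective M2 := (injective_iff_map_eq_zero _).2 i2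
  exact ccz_of f g (AddEquiv.ofBijective M1 (Finite.injective_iff_bijective.1 b1))
    (AddEquiv.ofBijective M2 (Finite.injective_iff_bijective.1 b2)) h

section
variable {K G : Type*} [Field K] [CommGroup G] [MulSemiringAction G K]

theorem cube_root [Fintype K] (m : ℕ) (hcard : Fintype.card K = 2 ^ m) (hme : Even m) (φ : G)
    (hφ : ∀ x : K, φ • x = x ^ 2) (k : ℕ) (hk : k.Coprime m) (u : K) (hu : u ≠ 0) :
    ∃ w, w ≠ 0 ∧ w * φ ^ k • w = u ^ 3 := by
  have hg : Nat.gcd (2 ^ k + 1) (2 ^ m - 1) ∣ 3 := by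
    have h1 : Nat.gcd (2 ^ k + 1) (2 ^ m - 1) ∣ Nat.gcd (2 ^ (2 * k) - 1) (2 ^ m - 1) := by
      apply Nat.gcd_dvd_gcd_of_dvd_left
      refine ⟨2 ^ k - 1, ?_⟩
      rw [← Nat.sq_sub_sq, ← pow_mul, mul_comm]
    rw [Nat.pow_sub_one_gcd_pow_sub_one] at h1
    obtain ⟨n, rfl⟩ := hme
    have : Nat.gcd (2 * k) (n + n) = 2 := by
      rw [← two_mul, Nat.gcd_mul_left]
      have : Nat.gcd k n = 1 := Nat.Coprime.coprime_dvd_right ⟨2, by ring⟩ hk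
      rw [this]
    rw [this] at h1
    exact h1
  obtain ⟨q, hq⟩ := hg
  have hb := Nat.gcd_eq_gcd_ab (2 ^ k + 1) (2 ^ m - 1)
  set A := Nat.gcdA (2 ^ k + 1) (2 ^ m - 1)
  set B := Nat.gcdB (2 ^ k + 1) (2 ^ m - 1)
  have hu1 : u ^ (2 ^ m - 1) = 1 := by
    rw [← hcard]; exact FiniteField.pow_card_sub_one_eq_one u hu
  refine ⟨u ^ (A * q), zpow_ne_zero _ hu, ?_⟩
  rw [pow_smul_eq φ hφ, ← pow_succ', ← zpow_natCast (u ^ (A * q)), ← zpow_mul]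
  have e : A * q * ((2 ^ k + 1 : ℕ) : ℤ) = (3 : ℕ) - ((2 ^ m - 1 : ℕ) : ℤ) * (B * q) := by
    rw [hq]; push_cast; rw [hb]; push_cast; ring
  rw [e, zpow_sub₀ hu, zpow_mul, zpow_natCast, zpow_natCast, hu1]
  simp

theorem noncubes [Finite K] (β β' : K) (hβ0 : β ≠ 0) (hβ'0 : β' ≠ 0)
    (hβ : ∀ x : K, x ^ 3 ≠ β) (hβ' : ∀ x : K, x ^ 3 ≠ β') :
    ∃ u : K, u ≠ 0 ∧ (β' = β * u ^ 3 ∨ β' = β ^ 2 * u ^ 3) := by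
  obtain ⟨ζ, hζ⟩ := IsCyclic.exists_generator (α := Kˣ)
  obtain ⟨i, hi⟩ := hζ (Units.mk0 β hβ0)
  obtain ⟨j, hj⟩ := hζ (Units.mk0 β' hβ'0)
  have hi' : β = (ζ : K) ^ i := by
    have := congrArg Units.val hi; simpa using this.symm
  have hj' : β' = (ζ : K) ^ j := by
    have := congrArg Units.val hj; simpa using this.symm
  have z0 : (ζ : K) ≠ 0 := ζ.ne_zero
  have n3 : ∀ n : ℤ, ((ζ : K) ^ n) ^ 3 = (ζ : K) ^ (3 * n) := by
    intro n; rw [mul_comm, zpow_mul]; norm_cast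
  have ni : ¬ (3 ∣ i) := by
    rintro ⟨n, rfl⟩
    exact hβ ((ζ : K) ^ n) (by rw [hi', n3])
  have nj : ¬ (3 ∣ j) := by
    rintro ⟨n, rfl⟩
    exact hβ' ((ζ : K) ^ n) (by rw [hj', n3])
  have : (3 ∣ j - i) ∨ (3 ∣ j - 2 * i) := by
    have i3 : i % 3 = 1 ∨ i % 3 = 2 := by omega
    have j3 : j % 3 = 1 ∨ j % 3 = 2 := by omega
    rcases i3 with i3 | i3 <;> rcases j3 with j3 | j3 <;> omega
  rcases this with ⟨n, hn⟩ | ⟨n, hn⟩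
  · refine ⟨(ζ : K) ^ n, zpow_ne_zero _ z0, Or.inl ?_⟩
    rw [n3, hi', hj', ← zpow_add₀ z0]; congr 1; omega
  · refine ⟨(ζ : K) ^ n, zpow_ne_zero _ z0, Or.inr ?_⟩
    rw [n3, hi', hj', ← zpow_natCast, ← zpow_mul, ← zpow_add₀ z0]; congr 1; push_cast; omega

theorem equiv_b [Module (ZMod 2) K] [Fintype K] [CharP K 2] (m : ℕ)
    (hcard : Fintype.card K = 2 ^ m)
    (hme : Even m) (φ : G) (hφ : ∀ x : K, φ • x = x ^ 2) (k : ℕ) (hk : k.Coprime m)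
    (β β' : K) (hβ0 : β ≠ 0) (hβ'0 : β' ≠ 0)
    (hβ : ∀ x : K, x ^ 3 ≠ β) (hβ' : ∀ x : K, x ^ 3 ≠ β') :
    CCZEquivalent (taniguchi k 0 β) (taniguchi k 0 β') := by
  obtain ⟨u, hu, huu⟩ := noncubes β β' hβ0 hβ'0 hβ hβ'
  obtain ⟨w, hw, hww⟩ := cube_root m hcard hme φ hφ k hk u hu
  have hsw : φ ^ k • w ≠ 0 := by rwa [Ne, smul_eq_zero_iff_eq]
  rw [← hww] at huu
  rcases huu with h | h
  · refine ccz_of' _ _ (fun p => (p.1, w⁻¹ * p.2)) (fun p => (p.1, w⁻¹ * p.2)) ?_ ?_ ?_ ?_ ?_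
    · intro x y; ext <;> simp [mul_add]
    · intro x y; ext <;> simp [mul_add]
    · rintro ⟨x, y⟩ h; simpa [hw] using h
    · rintro ⟨x, y⟩ h; simpa [hw] using h
    · rintro ⟨x, y⟩
      rw [tani_eq φ hφ, tani_eq φ hφ, h]
      ext
      · simp only [smul_mul', smul_inv₀']; field_simp
      · simp only; ring
  · refine ccz_of' _ _ (fun p => (p.1 ^ 2, w⁻¹ * p.2 ^ 2)) (fun p => (p.1 ^ 2, w⁻¹ * p.2 ^ 2))
      ?_ ?_ ?_ ?_ ?_
    · intro x y; ext <;> simp [mul_add, CharTwo.add_sq]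
    · intro x y; ext <;> simp [mul_add, CharTwo.add_sq]
    · rintro ⟨x, y⟩ h; simpa [hw] using h
    · rintro ⟨x, y⟩ h; simpa [hw] using h
    · rintro ⟨x, y⟩
      rw [tani_eq φ hφ, tani_eq φ hφ, h]
      ext
      · simp only [smul_mul', smul_inv₀', smul_pow', CharTwo.add_sq]; field_simp
      · simp only; ring

theorem equiv_a [Module (ZMod 2) K] [Fintype K] [CharP K 2] (m : ℕ)
    (hcard : Fintype.card K = 2 ^ m)
    (hme : Even m) (φ : G) (hφ : ∀ x : K, φ • x = x ^ 2) (ho : φ ^ m = 1) (k : ℕ) (hkm : k < m)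
    (hk : k.Coprime m)
    (β : K) (hβ0 : β ≠ 0) :
    CCZEquivalent (taniguchi k 0 β) (taniguchi (m - k) 0 β) := by
  obtain ⟨s, hs⟩ : ∃ s, s = φ ^ k := ⟨_, rfl⟩
  have ht : φ ^ (m - k) = s⁻¹ := by
    rw [eq_inv_iff_mul_eq_one, hs, ← pow_add, Nat.sub_add_cancel hkm.le, ho]
  have hu : (s * s) • β ≠ 0 := by rwa [Ne, smul_eq_zero_iff_eq]
  obtain ⟨d, hd, hdd⟩ := cube_root m hcard hme φ hφ k hk _ hu
  rw [← hs] at hdd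
  have hsd : s • d ≠ 0 := by rwa [Ne, smul_eq_zero_iff_eq]
  refine ccz_of' _ _ (fun p => (s • d * (s * s * s) • (p.2 ^ 2), (s * s * s) • (p.1 ^ 2)))
    (fun p => (β * p.1 ^ 2, s • d * (s * s * s) • (p.2 ^ 2))) ?_ ?_ ?_ ?_ ?_
  · intro x y; ext <;> simp [mul_add, CharTwo.add_sq]
  · intro x y; ext <;> simp [mul_add, CharTwo.add_sq]
  · rintro ⟨x, y⟩ h
    simp only [Prod.mk_eq_zero, mul_eq_zero, smul_eq_zero_iff_eq, hd, false_or, pow_eq_zero_iff,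
      ne_eq, OfNat.ofNat_ne_zero, not_false_eq_true] at h ⊢
    exact h.symm
  · rintro ⟨x, y⟩ h
    simpa only [Prod.mk_eq_zero, mul_eq_zero, smul_eq_zero_iff_eq, hd, hβ0, false_or,
      pow_eq_zero_iff, ne_eq, OfNat.ofNat_ne_zero, not_false_eq_true] using h
  · rintro ⟨x, y⟩
    rw [tani_eq φ hφ, tani_eq φ hφ, ht, ← hs]
    have hb : (s⁻¹ * s⁻¹) • (d * s • d) = β ^ 3 := by
      rw [hdd, smul_pow', ← mul_smul]; simp
    ext
    · have e1 : (s⁻¹ * s⁻¹) • (s⁻¹ • (s • d * (s * s * s) • y ^ 2) * (s • d * (s * s * s) • y ^ 2))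
          = β ^ 3 * (y ^ 2 * s • y ^ 2) := by
        rw [← hb]
        simp only [smul_mul', ← mul_smul, smul_pow']
        simp [mul_assoc]
        left; ring
      have e2 : s⁻¹ • (s * s * s) • x ^ 2 * (s * s * s) • x ^ 2
         = ((s * s) • (s • x * x)) ^ 2 := by
        simp only [smul_mul', ← mul_smul, smul_pow']
        simp [mul_assoc]
        ring
      simp only
      rw [e1, e2, CharTwo.add_sq, smul_pow']
      ring
    · simp only [mul_pow, smul_mul']
      ring

end

end Tani
namespace Tani

theorem odd_of (m k : ℕ) (hme : Even m) (hk : Nat.gcd k m = 1) : Odd k := by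
  by_contra h
  rw [Nat.not_odd_iff_even] at h
  have := Nat.dvd_gcd h.two_dvd hme.two_dvd
  rw [hk] at this
  omega

theorem not_equiv {K G : Type*} [Field K] [Fintype K] [Algebra (ZMod 2) K] [CharP K 2]
    [CommGroup G] [Fintype G] [MulSemiringAction G K] (hi : Ind K G) (hgen : Gen K G) (m : ℕ)
    (hm : 4 ≤ m) (hcard : Fintype.card K = 2 ^ m)
    (hme : Even m) (φ : G) (hφ : ∀ x : K, φ • x = x ^ 2) (ho : orderOf φ = m) (k l : ℕ)
    (hk0 : 0 < k) (hkm : 2 * k < m) (hl0 : 0 < l) (hlm : 2 * l < m)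
    (hk : Nat.gcd k m = 1) (hl : Nat.gcd l m = 1) (hkl : k ≠ l)
    (β β' : K) (hβ'0 : β' ≠ 0)
    (hβ : ∀ x : K, x ^ 3 ≠ β) (hβ' : ∀ x : K, x ^ 3 ≠ β')
    (hC : CCZEquivalent (taniguchi k 0 β) (taniguchi l 0 β')) : False := by
  classical
  have ko := odd_of m k hme hk
  have lo := odd_of m l hme hl
  have kc : k.Coprime (orderOf φ) := by rw [ho]; exact hk
  have lc : l.Coprime (orderOf φ) := by rw [ho]; exact hl
  obtain ⟨b, hb⟩ := ccz_b _ _ hC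
  have h2 : ∀ x : K × K, x + x = 0 := fun x => by
    ext <;> simp [CharTwo.add_self_eq_zero]
  have hcV : 8 < Fintype.card (K × K) := by
    rw [Fintype.card_prod, hcard]
    have : 2 ^ 4 ≤ 2 ^ m := Nat.pow_le_pow_right (by norm_num) hm
    nlinarith
  obtain ⟨a, Q, ha, haQ⟩ := ccz_ea h2 hcV _ _ _ _ (tani_apn φ hφ k ko kc β hβ)
    (tani_apn φ hφ l lo lc β' hβ') b hb
  have one : ∀ n, φ ^ n = 1 → m ∣ n := fun n h => by
    rw [← ho]; exact orderOf_dvd_of_pow_eq_one h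
  have hm6 : 4 < m := by
    rcases hm.lt_or_eq with h | h
    · exact h
    · exfalso; apply hkl; omega
  have cop : ∀ n, m ∣ n * k → m ∣ n := fun n h =>
    (Nat.Coprime.symm hk).dvd_of_dvd_mul_right h
  obtain ⟨k', rfl⟩ := ko
  obtain ⟨l', rfl⟩ := lo
  obtain ⟨n, rfl⟩ := hme
  refine noneq hi hgen (φ ^ (2 * k' + 1)) (φ ^ (2 * l' + 1)) ?_ ?_ ?_ ?_ ?_ ?_ ?_ ?_ ?_ ?_
    β β' hβ'0 a Q ha haQ
  · intro h
    have := Nat.le_of_dvd (by omega) (one _ h)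
    omega
  · intro h
    rw [← pow_add] at h
    have := Nat.le_of_dvd (by omega) (one _ h)
    omega
  · intro h
    rw [← pow_add, ← pow_add] at h
    have := Nat.le_of_dvd (by omega) (cop 3 (by convert one _ h using 1; ring))
    omega
  · intro h
    rw [← pow_add, ← pow_add, ← pow_add] at h
    have := Nat.le_of_dvd (by omega) (cop 4 (by convert one _ h using 1; ring))
    omega
  · intro h
    have := Nat.le_of_dvd (by omega) (one _ h)
    omega
  · intro h
    rw [pow_inj_mod, ho, Nat.mod_eq_of_lt (by omega), Nat.mod_eq_of_lt (by omega)] at h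
    omega
  · intro h
    rw [← pow_add] at h
    have := Nat.le_of_dvd (by omega) (one _ h)
    omega
  · intro h
    rw [← pow_add] at h
    have := Nat.le_of_dvd (by omega) (one _ h)
    omega
  · intro h
    rw [← pow_add, pow_inj_mod, ho, Nat.mod_eq_of_lt (by omega), Nat.mod_eq_of_lt (by omega)] at h
    omega
  · intro h
    rw [← pow_add, ← pow_add] at h
    obtain ⟨q, hq⟩ := one _ h
    rw [add_mul] at hq
    omega

end Tani

/-- Let `m ≥ 4` be even and `β, β' ∈ F_{2^m}^*` non-cubes.
(a) For `0 < k < m` coprime to `m`, the Taniguchi APN functions `f_{k,0,β}` and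
`f_{m-k,0,β}` are CCZ-equivalent.
(b) For `0 < k, ℓ < m/2` coprime to `m`, the Taniguchi APN functions `f_{k,0,β}` and
`f_{ℓ,0,β'}` are CCZ-equivalent if and only if `k = ℓ`. -/
theorem taniguchi_alpha_zero_equivalence (m : ℕ) (hm : 4 ≤ m) (hmeven : Even m)
    (β β' : GaloisField 2 m) (hβ0 : β ≠ 0) (hβ'0 : β' ≠ 0)
    (hβ : ∀ x : GaloisField 2 m, x ^ 3 ≠ β) (hβ' : ∀ x : GaloisField 2 m, x ^ 3 ≠ β') :
    (∀ k : ℕ, 0 < k → k < m → Nat.gcd k m = 1 →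
      CCZEquivalent (taniguchi k (0 : GaloisField 2 m) β)
        (taniguchi (m - k) (0 : GaloisField 2 m) β)) ∧
    (∀ k ℓ : ℕ, 0 < k → 2 * k < m → 0 < ℓ → 2 * ℓ < m →
      Nat.gcd k m = 1 → Nat.gcd ℓ m = 1 →
      (CCZEquivalent (taniguchi k (0 : GaloisField 2 m) β)
          (taniguchi ℓ (0 : GaloisField 2 m) β') ↔ k = ℓ)) := by
  classical
  have hm0 : m ≠ 0 := by omega
  let _ : Fintype (GaloisField 2 m) := Fintype.ofFinite _
  have hcard : Fintype.card (GaloisField 2 m) = 2 ^ m := by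
    rw [← Nat.card_eq_fintype_card]; exact GaloisField.card 2 m hm0
  obtain ⟨G, _, _, _, φ, hi, hgen, ho, hφ⟩ := Tani.setup (GaloisField 2 m)
  rw [GaloisField.finrank 2 hm0] at ho
  constructor
  · intro k _ hkm hk
    exact Tani.equiv_a m hcard hmeven φ hφ (by rw [← ho]; exact pow_orderOf_eq_one φ) k hkm hk
      β hβ0
  · intro k ℓ hk0 hkm hl0 hlm hk hl
    constructor
    · intro hC
      by_contra hkl
      exact Tani.not_equiv hi hgen m hm hcard hmeven φ hφ ho k ℓ hk0 hkm hl0 hlm hk hl hkl β β'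
        hβ'0 hβ hβ' hC
    · rintro rfl
      exact Tani.equiv_b m hcard hmeven φ hφ k hk β β' hβ0 hβ'0 hβ hβ'
end

section
/- Let m ≥ 3 be an integer and let k, ℓ be integers with 0 < k, ℓ < m/2 and gcd(k,m) = gcd(ℓ,m) = 1. Let β, β' ∈ F_{2^m}^* be such that the polynomials X^{2^k+1} + X + β and X^{2^ℓ+1} + X + β' have no roots in F_{2^m}. Then the Taniguchi APN functions f_{k,1,β} and f_{ℓ,1,β'} on F_{2^m} × F_{2^m} are CCZ-equivalent if and only if k = ℓ and β' = β^{2^i} for some i ∈ {0, …, m−1}. -/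
section CCZtoEA

open Finset

/-- The nontrivial sign character of `ZMod 2`. -/
def sgnChar (t : ZMod 2) : ℤ := if t = 0 then 1 else -1

lemma sgnChar_add (s t : ZMod 2) : sgnChar (s + t) = sgnChar s * sgnChar t := by
  revert s t; decide

lemma sgnChar_sq (s : ZMod 2) : sgnChar s ^ 2 = 1 := by
  revert s; decide

lemma sgnChar_zero : sgnChar 0 = 1 := by decide

/-- Orthogonality of characters. -/
lemma sum_sgnChar {H : Type*} [AddCommGroup H] [Fintype H] (h : H →+ ZMod 2) :
    ((∀ a, h a = 0) → ∑ a, sgnChar (h a) = Fintype.card H) ∧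
    ((¬ ∀ a, h a = 0) → ∑ a, sgnChar (h a) = 0) := by
  constructor
  · intro h0
    simp [h0, sgnChar_zero]
  · intro h0
    push Not at h0
    obtain ⟨b, hb⟩ := h0
    have hb1 : sgnChar (h b) = -1 := by simp [sgnChar, hb]
    have : ∑ a, sgnChar (h a) = ∑ a, sgnChar (h (a + b)) :=
      (Equiv.sum_comp (Equiv.addRight b) (fun a => sgnChar (h a))).symm
    simp only [map_add, sgnChar_add, hb1] at this
    rw [← Finset.sum_mul] at this
    linarith

variable {V : Type*} [AddCommGroup V] [Module (ZMod 2) V]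

lemma char_two_add_self (x : V) : x + x = 0 := by
  rw [← two_smul (ZMod 2) x]
  have : (2 : ZMod 2) = 0 := rfl
  rw [this, zero_smul]

/-- `f` is quadratic with polar form `B`. -/
def IsQuad (f : V → V) (B : V →ₗ[ZMod 2] V →ₗ[ZMod 2] V) : Prop :=
  ∀ x y, f (x + y) = f x + f y + B x y

/-- radical of the component `v ∘ B`. -/
def radB (B : V →ₗ[ZMod 2] V →ₗ[ZMod 2] V) (v : V →ₗ[ZMod 2] ZMod 2) :
    Submodule (ZMod 2) V := LinearMap.ker ((B.compr₂ v).flip)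

lemma mem_radB (B : V →ₗ[ZMod 2] V →ₗ[ZMod 2] V) (v : V →ₗ[ZMod 2] ZMod 2) (a : V) :
    a ∈ radB B v ↔ ∀ x, v (B x a) = 0 := by
  simp [radB, LinearMap.ext_iff]

variable [Fintype V]

/-- Walsh transform. -/
def walsh (f : V → V) (w : V × V →ₗ[ZMod 2] ZMod 2) : ℤ := ∑ x, sgnChar (w (x, f x))

open Classical in
lemma walsh_sq (f : V → V) (B : V →ₗ[ZMod 2] V →ₗ[ZMod 2] V) (hf : IsQuad f B)
    (w : V × V →ₗ[ZMod 2] ZMod 2) :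
    walsh f w ^ 2 = Fintype.card V * ∑ a : radB B (w ∘ₗ LinearMap.inr _ _ _),
      sgnChar (w (a.1, f a.1)) := by
  have key : ∀ x a, w (x, f x) + w (x + a, f (x + a))
      = w (a, f a) + w (0, B x a) := by
    intro x a
    rw [← map_add, ← map_add, hf x a]
    congr 1
    ext
    · simp only [Prod.mk_add_mk, add_zero]
      rw [← add_assoc, char_two_add_self, zero_add]
    · simp only [Prod.mk_add_mk]
      rw [← add_assoc, ← add_assoc, char_two_add_self, zero_add]
  have h1 : walsh f w ^ 2 = ∑ a, sgnChar (w (a, f a)) * ∑ x, sgnChar (w (0, B x a)) := by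
    have : walsh f w ^ 2 = ∑ x, ∑ y, sgnChar (w (x, f x)) * sgnChar (w (y, f y)) := by
      rw [sq, walsh, Finset.sum_mul_sum]
    rw [this]
    have : ∀ x, ∑ y, sgnChar (w (x, f x)) * sgnChar (w (y, f y))
        = ∑ a, sgnChar (w (a, f a)) * sgnChar (w (0, B x a)) := by
      intro x
      rw [← Equiv.sum_comp (Equiv.addLeft x)]
      refine Finset.sum_congr rfl fun a _ => ?_
      simp only [Equiv.coe_addLeft]
      rw [← sgnChar_add, key, sgnChar_add]
    simp only [this]
    rw [Finset.sum_comm]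
    simp only [Finset.mul_sum]
  rw [h1, Finset.mul_sum]
  have h2 : ∀ a, ∑ x, sgnChar (w (0, B x a)) =
      if a ∈ radB B (w ∘ₗ LinearMap.inr _ _ _) then (Fintype.card V : ℤ) else 0 := by
    intro a
    have hs := sum_sgnChar ((w ∘ₗ LinearMap.inr _ _ _ ∘ₗ B.flip a).toAddMonoidHom)
    simp only [LinearMap.toAddMonoidHom_coe, LinearMap.comp_apply, LinearMap.flip_apply,
      LinearMap.inr_apply] at hs
    split_ifs with h
    · rw [mem_radB] at h
      exact hs.1 h
    · rw [mem_radB] at h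
      exact hs.2 h
  simp only [h2, mul_ite, mul_zero]
  rw [← Finset.sum_filter]
  rw [Finset.sum_subtype (p := fun a => a ∈ radB B (w ∘ₗ LinearMap.inr _ _ _))
    (F := inferInstance)]
  · exact Finset.sum_congr rfl fun a _ => mul_comm _ _
  · simp

open Classical in
/-- the sum over the radical -/
lemma walsh_sq' (f : V → V) (B : V →ₗ[ZMod 2] V →ₗ[ZMod 2] V) (hf : IsQuad f B)
    (w : V × V →ₗ[ZMod 2] ZMod 2) :
    ((∀ a ∈ radB B (w ∘ₗ LinearMap.inr _ _ _), w (a, f a) = 0) → walsh f w ^ 2 =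
      Fintype.card V * Fintype.card (radB B (w ∘ₗ LinearMap.inr _ _ _))) ∧
    ((¬ ∀ a ∈ radB B (w ∘ₗ LinearMap.inr _ _ _), w (a, f a) = 0) → walsh f w ^ 2 = 0) := by
  rw [walsh_sq f B hf]
  let h : radB B (w ∘ₗ LinearMap.inr _ _ _) →+ ZMod 2 := AddMonoidHom.mk'
    (fun a => w (a.1, f a.1)) (by
      intro a b
      have hb := (mem_radB _ _ _).1 b.2 a.1
      simp only [LinearMap.comp_apply, LinearMap.inr_apply] at hb
      simp only [Submodule.coe_add]
      rw [hf, ← map_add]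
      have : ((a.1 + b.1, f a.1 + f b.1 + B a.1 b.1) : V × V)
        = ((a.1, f a.1) + (b.1, f b.1)) + (0, B a.1 b.1) := by simp
      rw [this, map_add, hb, add_zero])
  have hs := sum_sgnChar h
  constructor
  · intro h0
    rw [← hs.1 (fun a => h0 a.1 a.2)]
    rfl
  · intro h0
    have h1 := hs.2 (fun hh => h0 fun a ha => hh ⟨a, ha⟩)
    have h2 : ∑ a : radB B (w ∘ₗ LinearMap.inr _ _ _), sgnChar (w (a.1, f a.1)) = 0 := h1
    rw [h2, mul_zero]

/-- bent components -/
def Bent (B : V →ₗ[ZMod 2] V →ₗ[ZMod 2] V) (v : V →ₗ[ZMod 2] ZMod 2) : Prop := radB B v = ⊥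

lemma IsQuad.zero {f : V → V} {B : V →ₗ[ZMod 2] V →ₗ[ZMod 2] V} (hf : IsQuad f B) :
    f 0 = 0 := by
  have := hf 0 0
  simpa using this

lemma walsh_bent (f : V → V) (B : V →ₗ[ZMod 2] V →ₗ[ZMod 2] V) (hf : IsQuad f B)
    (w : V × V →ₗ[ZMod 2] ZMod 2) :
    walsh f w ^ 2 = Fintype.card V ↔ Bent B (w ∘ₗ LinearMap.inr _ _ _) := by
  classical
  have hc : (0 : ℤ) < Fintype.card V := by exact_mod_cast Fintype.card_pos
  obtain ⟨h1, h2⟩ := walsh_sq' f B hf w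
  constructor
  · intro h
    by_cases h0 : ∀ a ∈ radB B (w ∘ₗ LinearMap.inr _ _ _), w (a, f a) = 0
    · rw [h1 h0] at h
      have : (Fintype.card (radB B (w ∘ₗ LinearMap.inr _ _ _)) : ℤ) = 1 := by
        have h' : (Fintype.card V : ℤ) * Fintype.card (radB B (w ∘ₗ LinearMap.inr _ _ _))
          = Fintype.card V * 1 := by rw [h, mul_one]
        exact mul_left_cancel₀ hc.ne' h'
      have h3 : Fintype.card (radB B (w ∘ₗ LinearMap.inr _ _ _)) = 1 := by exact_mod_cast this
      rw [Fintype.card_eq_one_iff] at h3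
      obtain ⟨z, hz⟩ := h3
      rw [Bent, Submodule.eq_bot_iff]
      intro x hx
      have e1 := hz ⟨x, hx⟩
      have e2 := hz 0
      have := e1.trans e2.symm
      simpa using congrArg Subtype.val this
    · rw [h2 h0] at h
      omega
  · intro h
    rw [Bent] at h
    rw [h1]
    · have : Fintype.card (radB B (w ∘ₗ LinearMap.inr _ _ _)) = 1 := by
        rw [Fintype.card_eq_one_iff]
        refine ⟨0, fun y => ?_⟩
        have := y.2
        exact Subtype.ext ((Submodule.mem_bot _).1 (h.le this))
      rw [this]; simp
    · intro a ha
      rw [h, Submodule.mem_bot] at ha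
      subst ha
      rw [hf.zero]
      exact map_zero w

/-- If `|V|` is a square then the radical does not have two elements. -/
lemma card_radB_ne_two (f : V → V) (B : V →ₗ[ZMod 2] V →ₗ[ZMod 2] V) (hf : IsQuad f B)
    (m : ℕ) (hV : Fintype.card V = 2 ^ (2 * m))
    (v : V →ₗ[ZMod 2] ZMod 2) : Nat.card (radB B v) ≠ 2 := by
  classical
  intro h
  obtain ⟨a0, ha0⟩ : ∃ a : V, ∀ x, x ∈ radB B v ↔ x = 0 ∨ x = a := by
    rw [Nat.card_eq_two_iff' (0 : radB B v)] at h
    obtain ⟨y, hy, hu⟩ := h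
    refine ⟨y.1, fun x => ⟨fun hx => ?_, ?_⟩⟩
    · by_cases hx0 : x = 0
      · exact Or.inl hx0
      · right
        have := hu ⟨x, hx⟩ (by simpa [Subtype.ext_iff] using hx0)
        exact congrArg Subtype.val this
    · rintro (rfl | rfl)
      · exact zero_mem _
      · exact y.2
  have ha0' : a0 ≠ 0 := by
    rintro rfl
    have : radB B v = ⊥ := by
      ext x; rw [ha0]; simp
    rw [this] at h
    simp at h
  obtain ⟨u, hu⟩ : ∃ u : V →ₗ[ZMod 2] ZMod 2, u a0 = v (f a0) := by
    obtain ⟨u, hu, -⟩ := Submodule.exists_le_ker_of_notMem (K := ZMod 2) (p := (⊥ : Submodule (ZMod 2) V))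
      (v := a0) (by simpa using ha0')
    refine ⟨(v (f a0)) • u, ?_⟩
    have hu1 : u a0 = 1 := by
      generalize u a0 = t at hu
      revert t; decide
    simp [hu1]
  let w : V × V →ₗ[ZMod 2] ZMod 2 := u.coprod v
  have hw : w ∘ₗ LinearMap.inr _ _ _ = v := by simp [w]
  have hs := (walsh_sq' f B hf w).1
  rw [hw] at hs
  have hs' := hs (by
    intro a ha
    rw [ha0] at ha
    rcases ha with rfl | rfl
    · simp [w, hf.zero]
    · simp only [w, LinearMap.coprod_apply, hu]
      exact char_two_add_self _)
  rw [← Nat.card_eq_fintype_card (α := radB B v), h, hV] at hs'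
  have h2 : (walsh f w).natAbs ^ 2 = 2 ^ (2 * m + 1) := by
    zify
    rw [sq_abs, hs']
    push_cast; ring
  obtain ⟨j, -, hj⟩ := (Nat.dvd_prime_pow Nat.prime_two).1 (h2 ▸ dvd_pow_self _ two_ne_zero :
    (walsh f w).natAbs ∣ 2 ^ (2 * m + 1))
  rw [hj, ← pow_mul] at h2
  have := Nat.pow_right_injective le_rfl h2
  omega

/-- APN property of the polar form. -/
def IsAPNForm (B : V →ₗ[ZMod 2] V →ₗ[ZMod 2] V) : Prop :=
  ∀ a, a ≠ 0 → ∀ x, B x a = 0 ↔ x = 0 ∨ x = a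

instance finDual : Finite (V →ₗ[ZMod 2] ZMod 2) :=
  Finite.of_injective (fun f => (f : V → ZMod 2)) DFunLike.coe_injective

lemma card_dual' (U : Type*) [AddCommGroup U] [Module (ZMod 2) U] [Finite U] :
    Nat.card (U →ₗ[ZMod 2] ZMod 2) = Nat.card U := by
  have : Finite (U →ₗ[ZMod 2] ZMod 2) :=
    Finite.of_injective (fun f => (f : U → ZMod 2)) DFunLike.coe_injective
  rw [Module.natCard_eq_pow_finrank (K := ZMod 2) (V := U),
    Module.natCard_eq_pow_finrank (K := ZMod 2) (V := U →ₗ[ZMod 2] ZMod 2)]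
  congr 1
  exact Subspace.dual_finrank_eq

lemma card_ann (B : V →ₗ[ZMod 2] V →ₗ[ZMod 2] V) (hB : IsAPNForm B) (a : V) (ha : a ≠ 0) :
    Nat.card {v : V →ₗ[ZMod 2] ZMod 2 // a ∈ radB B v} = 2 := by
  let R := LinearMap.range (B.flip a)
  have e : {v : V →ₗ[ZMod 2] ZMod 2 // a ∈ radB B v} ≃ R.dualAnnihilator := by
    refine Equiv.subtypeEquivRight fun v => ?_
    rw [mem_radB, Submodule.mem_dualAnnihilator]
    simp [R]
  rw [Nat.card_congr e]
  have hk : Nat.card (LinearMap.ker (B.flip a)) = 2 := by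
    rw [Nat.card_eq_two_iff' 0]
    refine ⟨⟨a, ?_⟩, ?_, ?_⟩
    · rw [LinearMap.mem_ker, LinearMap.flip_apply, hB a ha]; exact Or.inr rfl
    · simpa [Subtype.ext_iff] using ha
    · rintro ⟨y, hy⟩ hy0
      rw [LinearMap.mem_ker, LinearMap.flip_apply, hB a ha] at hy
      rcases hy with rfl | rfl
      · exact absurd rfl hy0
      · rfl
  have h1 : Module.finrank (ZMod 2) (LinearMap.ker (B.flip a)) = 1 := by
    rw [Module.natCard_eq_pow_finrank (K := ZMod 2), Nat.card_zmod] at hk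
    exact Nat.pow_right_injective le_rfl (hk.trans (pow_one 2).symm)
  have h2 := LinearMap.finrank_range_add_finrank_ker (B.flip a)
  have h3 := Subspace.finrank_add_finrank_dualAnnihilator_eq R
  have h4 : Module.finrank (ZMod 2) R.dualAnnihilator = 1 := by
    simp only [R] at h3 ⊢
    omega
  rw [Module.natCard_eq_pow_finrank (K := ZMod 2), Nat.card_zmod, h4, pow_one]

lemma card_radB_mod (f : V → V) (B : V →ₗ[ZMod 2] V →ₗ[ZMod 2] V) (hf : IsQuad f B)
    (m : ℕ) (hV : Fintype.card V = 2 ^ (2 * m)) (v : V →ₗ[ZMod 2] ZMod 2) :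
    (Bent B v → Nat.card (radB B v) % 4 = 1) ∧ (¬ Bent B v → Nat.card (radB B v) % 4 = 0) := by
  have h2 := card_radB_ne_two f B hf m hV v
  rw [Module.natCard_eq_pow_finrank (K := ZMod 2), Nat.card_zmod] at *
  constructor
  · intro h
    rw [Bent] at h
    rw [h]; simp
  · intro h
    rcases hj : Module.finrank (ZMod 2) (radB B v) with _ | _ | j
    · exact absurd (Submodule.finrank_eq_zero.1 hj) h
    · rw [hj] at h2; simp at h2
    · rw [pow_succ, pow_succ]; omega

lemma card_bent (f : V → V) (B : V →ₗ[ZMod 2] V →ₗ[ZMod 2] V) (hf : IsQuad f B)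
    (hB : IsAPNForm B)
    (m : ℕ) (hm : m ≠ 0) (hV : Fintype.card V = 2 ^ (2 * m)) :
    Nat.card {v : V →ₗ[ZMod 2] ZMod 2 // Bent B v} % 4 = 2 := by
  classical
  let _ : Fintype (V →ₗ[ZMod 2] ZMod 2) := Fintype.ofFinite _
  have h4 : 4 ∣ Fintype.card V := by
    rw [hV, pow_mul]; exact dvd_pow_self _ hm
  have e1 : ∑ v : V →ₗ[ZMod 2] ZMod 2, Nat.card (radB B v)
      = ∑ a : V, Nat.card {v : V →ₗ[ZMod 2] ZMod 2 // a ∈ radB B v} := by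
    have t1 : ∀ v : V →ₗ[ZMod 2] ZMod 2, Nat.card (radB B v)
        = ∑ a : V, if a ∈ radB B v then 1 else 0 := by
      intro v
      rw [Finset.sum_boole, Nat.card_eq_fintype_card, Fintype.card_subtype]; simp
    have t2 : ∀ a : V, Nat.card {v : V →ₗ[ZMod 2] ZMod 2 // a ∈ radB B v}
        = ∑ v : V →ₗ[ZMod 2] ZMod 2, if a ∈ radB B v then 1 else 0 := by
      intro a
      rw [Finset.sum_boole, Nat.card_eq_fintype_card, Fintype.card_subtype]; simp
    simp only [t1, t2]
    exact Finset.sum_comm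
  have e2 : ∑ a : V, Nat.card {v : V →ₗ[ZMod 2] ZMod 2 // a ∈ radB B v}
      = Fintype.card V + 2 * (Fintype.card V - 1) := by
    rw [← Finset.add_sum_erase _ _ (Finset.mem_univ (0 : V))]
    congr 1
    · rw [← Nat.card_eq_fintype_card (α := V), ← card_dual' V]
      exact Nat.card_congr (Equiv.subtypeUnivEquiv fun v => zero_mem _)
    · rw [Finset.sum_congr rfl (fun a ha => card_ann B hB a (Finset.ne_of_mem_erase ha))]
      simp [Finset.card_erase_of_mem, mul_comm]
  have e3 : (∑ v : V →ₗ[ZMod 2] ZMod 2, Nat.card (radB B v)) % 4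
      = (∑ v : V →ₗ[ZMod 2] ZMod 2, if Bent B v then 1 else 0) % 4 := by
    rw [Finset.sum_nat_mod]
    conv_rhs => rw [Finset.sum_nat_mod]
    congr 1
    refine Finset.sum_congr rfl fun v _ => ?_
    have := card_radB_mod f B hf m hV v
    split_ifs with h
    · exact this.1 h
    · exact this.2 h
  have e4 : (∑ v : V →ₗ[ZMod 2] ZMod 2, if Bent B v then 1 else 0)
      = Nat.card {v : V →ₗ[ZMod 2] ZMod 2 // Bent B v} := by
    rw [Finset.sum_boole, Nat.card_eq_fintype_card, Fintype.card_subtype]; simp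
  rw [← e4, ← e3, e1, e2]
  have : 0 < Fintype.card V := Fintype.card_pos
  omega

/-- translations stabilizing the set of bent components -/
def stabBent (B : V →ₗ[ZMod 2] V →ₗ[ZMod 2] V) : AddSubgroup (V →ₗ[ZMod 2] ZMod 2) where
  carrier := {p | ∀ v, Bent B v ↔ Bent B (v + p)}
  zero_mem' := by intro v; simp
  add_mem' := by
    intro p q hp hq v
    rw [hp v, hq (v + p), add_assoc]
  neg_mem' := by
    intro p hp v
    rw [hp (v + -p)]; simp

lemma stabBent_card (f : V → V) (B : V →ₗ[ZMod 2] V →ₗ[ZMod 2] V) (hf : IsQuad f B)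
    (hB : IsAPNForm B)
    (m : ℕ) (hm : m ≠ 0) (hV : Fintype.card V = 2 ^ (2 * m)) :
    Nat.card (stabBent B) ≤ 2 := by
  have h1 : Nat.card (stabBent B) ∣ Nat.card {v : V →ₗ[ZMod 2] ZMod 2 // Bent B v} := by
    let S : Set (V →ₗ[ZMod 2] ZMod 2) := {v | Bent B v}
    let T : Set ((V →ₗ[ZMod 2] ZMod 2) ⧸ stabBent B) := QuotientAddGroup.mk '' S
    have hST : (QuotientAddGroup.mk ⁻¹' T : Set (V →ₗ[ZMod 2] ZMod 2)) = S := by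
      ext v
      constructor
      · rintro ⟨u, hu, huv⟩
        have h := QuotientAddGroup.eq.1 huv
        have h' := (h u).1 hu
        simpa [S] using h'
      · intro hv
        exact ⟨v, hv, rfl⟩
    have e := QuotientAddGroup.preimageMkEquivAddSubgroupProdSet (stabBent B) T
    have h2 := Nat.card_congr e
    rw [hST, Nat.card_prod] at h2
    exact ⟨_, h2⟩
  have h2 : Nat.card (stabBent B) ∣ 2 ^ (2 * m) := by
    rw [← hV, ← Nat.card_eq_fintype_card, ← card_dual' V]
    exact AddSubgroup.card_addSubgroup_dvd_card _
  obtain ⟨j, -, hj⟩ := (Nat.dvd_prime_pow Nat.prime_two).1 h2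
  have h3 := card_bent f B hf hB m hm hV
  rw [hj] at h1 ⊢
  rcases j with _ | _ | j
  · simp
  · simp
  · rw [pow_succ, pow_succ, mul_assoc] at h1
    have := dvd_trans (dvd_mul_left (2 * 2) (2 ^ j)) h1
    omega

/-- Main criterion for the stabilizer to be trivial. -/
lemma stabBent_trivial (f : V → V) (B : V →ₗ[ZMod 2] V →ₗ[ZMod 2] V) (hf : IsQuad f B)
    (hB : IsAPNForm B)
    (m : ℕ) (hm : m ≠ 0) (hV : Fintype.card V = 2 ^ (2 * m))
    (T D : V ≃ₗ[ZMod 2] V) (hTD : ∀ x y, B (T x) (T y) = D (B x y))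
    (hD : ∀ y, ∃ z, y = D z + z) (p : V →ₗ[ZMod 2] ZMod 2) (hp : p ∈ stabBent B) : p = 0 := by
  have hbent : ∀ v : V →ₗ[ZMod 2] ZMod 2, Bent B (v ∘ₗ D.toLinearMap) ↔ Bent B v := by
    intro v
    have key : ∀ a, a ∈ radB B (v ∘ₗ D.toLinearMap) ↔ T a ∈ radB B v := by
      intro a
      rw [mem_radB, mem_radB]
      constructor
      · intro h x
        have := h (T.symm x)
        simp only [LinearMap.comp_apply, LinearEquiv.coe_coe, ← hTD] at this
        simpa using this
      · intro h x
        simp only [LinearMap.comp_apply, LinearEquiv.coe_coe, ← hTD]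
        exact h _
    rw [Bent, Bent, Submodule.eq_bot_iff, Submodule.eq_bot_iff]
    constructor
    · intro h x hx
      have := h (T.symm x) ((key _).2 (by simpa using hx))
      simpa using this
    · intro h x hx
      have := h _ ((key x).1 hx)
      simpa using this
  have hp' : p ∘ₗ D.toLinearMap ∈ stabBent B := by
    intro v
    have : v = (v ∘ₗ D.symm.toLinearMap) ∘ₗ D.toLinearMap := by ext; simp
    rw [this, ← LinearMap.add_comp, hbent, hbent]
    exact hp _
  by_contra hp0
  have hfix : p ∘ₗ D.toLinearMap = p := by
    by_contra hne
    have hne0 : p ∘ₗ D.toLinearMap ≠ 0 := by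
      intro h0
      apply hp0
      ext x
      have := LinearMap.congr_fun h0 (D.symm x)
      simpa using this
    have hc := stabBent_card f B hf hB m hm hV
    have h3 : 3 ≤ Nat.card (stabBent B) := by
      let s : Finset (stabBent B) := {0, ⟨p, hp⟩, ⟨_, hp'⟩}
      have hs : s.card = 3 := by
        rw [Finset.card_eq_three]
        refine ⟨_, _, _, ?_, ?_, ?_, rfl⟩
        · intro h; exact hp0 (congrArg Subtype.val h).symm
        · intro h; exact hne0 (congrArg Subtype.val h).symm
        · intro h; exact hne (congrArg Subtype.val h).symm
      let _ := Fintype.ofFinite (stabBent B)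
      rw [← hs, Nat.card_eq_fintype_card]
      exact Finset.card_le_univ s
    omega
  apply hp0
  ext y
  obtain ⟨z, rfl⟩ := hD y
  have := LinearMap.congr_fun hfix z
  simp only [LinearMap.comp_apply, LinearEquiv.coe_coe] at this
  rw [map_add, this, LinearMap.zero_apply]
  exact char_two_add_self _

lemma walsh_ccz (f g : V → V) (A : V × V →ₗ[ZMod 2] V × V) (c : V × V)
    (hA : Function.Bijective A)
    (h : (fun p => A p + c) '' {p : V × V | p.2 = f p.1} = {p : V × V | p.2 = g p.1})
    (w : V × V →ₗ[ZMod 2] ZMod 2) : walsh g w ^ 2 = walsh f (w ∘ₗ A) ^ 2 := by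
  have hg : ∀ x, (A (x, f x) + c).2 = g (A (x, f x) + c).1 := by
    intro x
    have : A (x, f x) + c ∈ {p : V × V | p.2 = g p.1} := by
      rw [← h]; exact ⟨(x, f x), rfl, rfl⟩
    exact this
  let π : V → V := fun x => (A (x, f x) + c).1
  have hπ : Function.Injective π := by
    intro x y hxy
    have h2 : A (x, f x) + c = A (y, f y) + c := by
      apply Prod.ext hxy
      rw [hg, hg]
      exact congrArg g hxy
    have := hA.1 (add_right_cancel h2)
    exact congrArg Prod.fst this
  have hπ' : Function.Bijective π := Finite.injective_iff_bijective.1 hπ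
  have : walsh g w = walsh f (w ∘ₗ A) * sgnChar (w c) := by
    rw [walsh, ← hπ'.sum_comp, walsh, Finset.sum_mul]
    refine Finset.sum_congr rfl fun x _ => ?_
    have : (π x, g (π x)) = A (x, f x) + c := Prod.ext rfl (hg x).symm
    rw [this, map_add, sgnChar_add, LinearMap.comp_apply]
  rw [this, mul_pow, sgnChar_sq, mul_one]

/-- CCZ-equivalence of quadratic functions implies equivalence of polar forms. -/
lemma ccz_to_linear (f g : V → V) (Bf Bg : V →ₗ[ZMod 2] V →ₗ[ZMod 2] V) (hf : IsQuad f Bf)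
    (hg : IsQuad g Bg) (hst : ∀ p ∈ stabBent Bg, p = 0) (h : CCZEquivalent f g) :
    ∃ L N : V →ₗ[ZMod 2] V, Function.Bijective N ∧ ∀ x y, Bg (L x) (L y) = N (Bf x y) := by
  obtain ⟨A', c, hA', hA, himg⟩ := h
  let A : V × V →ₗ[ZMod 2] V × V := hA'.mk' A'
  have hAb : Function.Bijective A := hA
  have himg' : (fun p => A p + c) '' {p : V × V | p.2 = f p.1} = {p : V × V | p.2 = g p.1} := himg
  have hz : ∀ z : V × V →ₗ[ZMod 2] ZMod 2, (∀ y, z (A (0, y)) = 0) → ∀ y, z (0, y) = 0 := by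
    intro z hzA
    have : z ∘ₗ LinearMap.inr _ _ _ ∈ stabBent Bg := by
      intro v
      have e1 : (v ∘ₗ LinearMap.snd (ZMod 2) V V) ∘ₗ LinearMap.inr _ _ _ = v := by ext; simp
      have e2 : (v ∘ₗ LinearMap.snd (ZMod 2) V V + z) ∘ₗ LinearMap.inr _ _ _
        = v + z ∘ₗ LinearMap.inr _ _ _ := by ext; simp
      rw [← e2]
      conv_lhs => rw [← e1]
      rw [← walsh_bent g Bg hg, ← walsh_bent g Bg hg, walsh_ccz f g A c hAb himg',
        walsh_ccz f g A c hAb himg', walsh_bent f Bf hf, walsh_bent f Bf hf]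
      have e3 : ((v ∘ₗ LinearMap.snd (ZMod 2) V V + z) ∘ₗ A) ∘ₗ LinearMap.inr _ _ _
        = ((v ∘ₗ LinearMap.snd (ZMod 2) V V) ∘ₗ A) ∘ₗ LinearMap.inr _ _ _ := by
        ext y
        simp [hzA]
      rw [e3]
    have h0 := hst _ this
    intro y
    exact LinearMap.congr_fun h0 y
  have hS : ∀ y, ∃ y', A (0, y') = (0, y) := by
    intro y
    by_contra hcon
    have hnot : ((0, y) : V × V) ∉ LinearMap.range (A ∘ₗ LinearMap.inr (ZMod 2) V V) := by
      rintro ⟨y', hy'⟩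
      exact hcon ⟨y', hy'⟩
    obtain ⟨z, hz1, hz2⟩ := Submodule.exists_le_ker_of_notMem hnot
    exact hz1 (hz z (fun y' => hz2 ⟨y', rfl⟩) y)
  choose S hS using hS
  have hSi : Function.Injective S := by
    intro a b hab
    have := hS a
    rw [hab, hS b] at this
    exact (congrArg Prod.snd this).symm
  have hSs : Function.Surjective S := Finite.injective_iff_surjective.1 hSi
  have hA0 : ∀ y, (A (0, y)).1 = 0 := by
    intro y
    obtain ⟨z, rfl⟩ := hSs y
    rw [hS]
  let N : V →ₗ[ZMod 2] V := LinearMap.snd _ _ _ ∘ₗ A ∘ₗ LinearMap.inr _ _ _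
  let L : V →ₗ[ZMod 2] V := LinearMap.fst _ _ _ ∘ₗ A ∘ₗ LinearMap.inl _ _ _
  let M : V →ₗ[ZMod 2] V := LinearMap.snd _ _ _ ∘ₗ A ∘ₗ LinearMap.inl _ _ _
  have hgr : ∀ x, g (L x + c.1) = M x + N (f x) + c.2 := by
    intro x
    have h1 : A (x, f x) + c ∈ {p : V × V | p.2 = g p.1} := by
      rw [← himg']; exact ⟨(x, f x), rfl, rfl⟩
    have h2 : A (x, f x) = A (x, 0) + A (0, f x) := by rw [← map_add]; simp
    have h3 : (A (x, f x) + c).2 = g (A (x, f x) + c).1 := h1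
    rw [h2] at h3
    simp only [Prod.snd_add, Prod.fst_add, hA0, add_zero] at h3
    exact h3.symm
  refine ⟨L, N, ?_, ?_⟩
  · have : Function.Surjective N := by
      intro y
      refine ⟨S y, ?_⟩
      change (A (0, S y)).2 = y
      rw [hS]
    exact Finite.surjective_iff_bijective.1 this
  · intro x y
    have h1 := hgr (x + y)
    have h2 := hgr x
    have h3 := hgr y
    have h4 := hgr 0
    rw [hf.zero] at h4
    simp only [map_zero, zero_add] at h4
    rw [hf, map_add, map_add, map_add, map_add] at h1
    rw [hg, hg] at h1
    rw [hg] at h2 h3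
    simp only [map_add, LinearMap.add_apply] at h1
    have hd : ∀ a : V, a + a = 0 := char_two_add_self
    have hn : ∀ a : V, -a = a := fun a => neg_eq_of_add_eq_zero_left (hd a)
    have e2 : N (f x) = g (L x) + g c.1 + Bg (L x) c.1 - M x - c.2 := by
      rw [h2]; abel
    have e3 : N (f y) = g (L y) + g c.1 + Bg (L y) c.1 - M y - c.2 := by
      rw [h3]; abel
    rw [e2, e3, h4] at h1
    have h5 : Bg (L x) (L y) = N (Bf x y) + (- c.2 - c.2 ) + (c.2 + c.2) := by
      have h6 := congrArg (fun t => t - (g (L x) + g (L y)) - c.2 - Bg (L x) c.1 - Bg (L y) c.1) h1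
      calc Bg (L x) (L y) = g (L x) + g (L y) + (Bg (L x)) (L y) + c.2 + ((Bg (L x)) c.1 + (Bg (L y)) c.1) - (g (L x) + g (L y)) - c.2 - Bg (L x) c.1 - Bg (L y) c.1 := by abel
        _ = _ := h6
        _ = _ := by abel
    rw [h5]; abel

end CCZtoEA
section Linearized

variable {K : Type*} [Field K] [Finite K] [Algebra (ZMod 2) K]

noncomputable instance galFintype : Fintype (K ≃ₐ[ZMod 2] K) := Fintype.ofFinite _

lemma gal_linearIndependent :
    LinearIndependent K (fun σ : K ≃ₐ[ZMod 2] K => (σ.toAlgHom.toLinearMap : K →ₗ[ZMod 2] K)) := by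
  refine (linearIndependent_toLinearMap (ZMod 2) K K).comp
    (fun σ : K ≃ₐ[ZMod 2] K => (σ.toAlgHom : K →ₐ[ZMod 2] K)) ?_
  intro σ τ h
  ext x
  exact AlgHom.congr_fun h x

lemma exists_linearized (L : K →ₗ[ZMod 2] K) :
    ∃ c : (K ≃ₐ[ZMod 2] K) → K, ∀ x, L x = ∑ σ, c σ * σ x := by
  have h := gal_linearIndependent (K := K).span_eq_top_of_card_eq_finrank (by
    rw [Module.finrank_linearMap_self, ← IsGalois.card_aut_eq_finrank, Nat.card_eq_fintype_card])
  have hL : L ∈ (⊤ : Submodule K (K →ₗ[ZMod 2] K)) := trivial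
  rw [← h, Submodule.mem_span_range_iff_exists_fun] at hL
  obtain ⟨c, rfl⟩ := hL
  exact ⟨c, fun x => by simp⟩

lemma linearized_indep (c : (K ≃ₐ[ZMod 2] K) → K) (h : ∀ x, ∑ σ, c σ * σ x = 0) (σ) :
    c σ = 0 := by
  refine (Fintype.linearIndependent_iff.1 (gal_linearIndependent (K := K))) c ?_ σ
  ext x
  simpa using h x

/-- bilinear form with coefficient matrix `M` -/
noncomputable def ev (M : (K ≃ₐ[ZMod 2] K) → (K ≃ₐ[ZMod 2] K) → K) (x y : K) : K :=
  ∑ σ, ∑ τ, M σ τ * (σ x * τ y)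

lemma ev_add (M M' : (K ≃ₐ[ZMod 2] K) → (K ≃ₐ[ZMod 2] K) → K) (x y : K) :
    ev M x y + ev M' x y = ev (fun σ τ => M σ τ + M' σ τ) x y := by
  simp only [ev, add_mul, Finset.sum_add_distrib]

lemma ev_inj (M M' : (K ≃ₐ[ZMod 2] K) → (K ≃ₐ[ZMod 2] K) → K)
    (h : ∀ x y, ev M x y = ev M' x y) (σ τ) : M σ τ = M' σ τ := by
  rw [← sub_eq_zero]
  refine linearized_indep (fun τ => M σ τ - M' σ τ) (fun y => ?_) τ
  refine linearized_indep (fun σ => ∑ τ, (M σ τ - M' σ τ) * τ y) (fun x => ?_) σ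
  have := sub_eq_zero.2 (h x y)
  simp only [ev] at this
  rw [← Finset.sum_sub_distrib] at this
  rw [← this]
  refine Finset.sum_congr rfl fun σ _ => ?_
  rw [Finset.sum_mul, ← Finset.sum_sub_distrib]
  refine Finset.sum_congr rfl fun τ _ => ?_
  ring

lemma ev_prod (a b : (K ≃ₐ[ZMod 2] K) → K) (x y : K) :
    (∑ σ, a σ * σ x) * (∑ σ, b σ * σ y) = ev (fun σ τ => a σ * b τ) x y := by
  rw [ev, Finset.sum_mul_sum]
  refine Finset.sum_congr rfl fun σ _ => Finset.sum_congr rfl fun τ _ => ?_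
  ring

open Classical in
lemma ev_twist (c : (K ≃ₐ[ZMod 2] K) → K) (γ : K) (φ₁ φ₂ : K ≃ₐ[ZMod 2] K) (x y : K) :
    ∑ ρ, c ρ * ρ (γ * (φ₁ x * φ₂ y)) = ev (fun σ τ =>
      if σ * φ₁⁻¹ = τ * φ₂⁻¹ then c (σ * φ₁⁻¹) * (σ * φ₁⁻¹) γ else 0) x y := by
  rw [ev]
  conv_rhs => rw [← (Equiv.sum_comp (Equiv.mulRight φ₁))]
  refine Finset.sum_congr rfl fun ρ _ => ?_
  rw [Finset.sum_eq_single (ρ * φ₂)]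
  · simp [AlgEquiv.mul_apply]; ring
  · intro τ _ hτ
    rw [if_neg, zero_mul]
    intro h
    apply hτ
    simp only [Equiv.coe_mulRight, mul_inv_cancel_right] at h
    rw [h]; simp
  · simp

open Classical in
lemma ev_single (κ : K) (σ₀ τ₀ : K ≃ₐ[ZMod 2] K) (x y : K) :
    κ * (σ₀ x * τ₀ y) = ev (fun σ τ => if σ = σ₀ ∧ τ = τ₀ then κ else 0) x y := by
  rw [ev, Finset.sum_eq_single σ₀, Finset.sum_eq_single τ₀]
  · simp
  · intro τ _ h; simp [h]
  · simp
  · intro τ _ h; simp [h]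
  · simp

/-- The polar form of the Taniguchi function. -/
noncomputable def tB (φ : K ≃ₐ[ZMod 2] K) (β : K) :
    (K × K) →ₗ[ZMod 2] (K × K) →ₗ[ZMod 2] (K × K) :=
  LinearMap.mk₂ (ZMod 2) (fun u w =>
    ((φ ^ 3) u.1 * (φ ^ 2) w.1 + (φ ^ 2) u.1 * (φ ^ 3) w.1
      + (φ ^ 2) u.1 * φ w.2 + φ u.2 * (φ ^ 2) w.1
      + (β * (φ u.2 * w.2) + β * (u.2 * φ w.2)), u.1 * w.2 + u.2 * w.1))
    (by intro a b c; ext <;> simp <;> ring)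
    (by intro a b c; ext <;> simp [Algebra.smul_def] <;> ring)
    (by intro a b c; ext <;> simp <;> ring)
    (by intro a b c; ext <;> simp [Algebra.smul_def] <;> ring)

lemma K_add_self (x : K) : x + x = 0 := char_two_add_self x

lemma tB_fst (φ : K ≃ₐ[ZMod 2] K) (β : K) (u w : K × K) : (tB φ β u w).1 =
    (φ ^ 3) u.1 * (φ ^ 2) w.1 + (φ ^ 2) u.1 * (φ ^ 3) w.1
      + (φ ^ 2) u.1 * φ w.2 + φ u.2 * (φ ^ 2) w.1
      + (β * (φ u.2 * w.2) + β * (u.2 * φ w.2)) := rfl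

lemma tB_snd (φ : K ≃ₐ[ZMod 2] K) (β : K) (u w : K × K) : (tB φ β u w).2 =
    u.1 * w.2 + u.2 * w.1 := rfl

/-- a vector in `K²` killed by two independent functionals is zero. -/
lemma det_zero {p q r s x y : K} (h : p * s + r * q ≠ 0) (h1 : p * y + x * q = 0)
    (h2 : r * y + x * s = 0) : x = 0 ∧ y = 0 := by
  have h2' : (2 : K) = 0 := by
    have := K_add_self (1 : K)
    rwa [one_add_one_eq_two] at this
  constructor
  · have : x * (p * s + r * q) = 0 := by
      linear_combination p * h2 + r * h1 - p * r * y * h2'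
    exact (mul_eq_zero.1 this).resolve_right h
  · have : y * (p * s + r * q) = 0 := by
      linear_combination s * h1 + q * h2 - x * q * s * h2'
    exact (mul_eq_zero.1 this).resolve_right h

/-- A component of a linear map `K × K → K × K`. -/
lemma exists_linearized₂ (L : K × K →ₗ[ZMod 2] K) :
    ∃ a a' : (K ≃ₐ[ZMod 2] K) → K, ∀ x y, L (x, y) = ∑ σ, a σ * σ x + ∑ σ, a' σ * σ y := by
  obtain ⟨a, ha⟩ := exists_linearized (L ∘ₗ LinearMap.inl _ _ _)
  obtain ⟨a', ha'⟩ := exists_linearized (L ∘ₗ LinearMap.inr _ _ _)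
  refine ⟨a, a', fun x y => ?_⟩
  rw [← ha, ← ha', LinearMap.comp_apply, LinearMap.comp_apply, ← map_add]
  simp

/-- Step A: `L` is semilinear. -/
lemma stepA (φ ψ : K ≃ₐ[ZMod 2] K) (h1 : φ ≠ 1) (h2 : φ ^ 2 ≠ 1) (h3 : φ ^ 3 ≠ 1)
    (β β' : K) (hβ : β ≠ 0) (L N : K × K →ₗ[ZMod 2] K × K) (hN : Function.Bijective N)
    (h : ∀ u w, tB ψ β' (L u) (L w) = N (tB φ β u w)) :
    (∀ z, (N (z, 0)).2 = 0) ∧ ∃ (τ : K ≃ₐ[ZMod 2] K) (a a' b b' : K), a * b' + a' * b ≠ 0 ∧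
      ∀ x y, L (x, y) = (a * τ x + a' * τ y, b * τ x + b' * τ y) := by
  classical
  obtain ⟨a, a', hLa⟩ := exists_linearized₂ (LinearMap.fst _ _ _ ∘ₗ L)
  obtain ⟨b, b', hLb⟩ := exists_linearized₂ (LinearMap.snd _ _ _ ∘ₗ L)
  obtain ⟨c, d, hN2⟩ := exists_linearized₂ (LinearMap.snd _ _ _ ∘ₗ N)
  simp only [LinearMap.comp_apply, LinearMap.fst_apply, LinearMap.snd_apply] at hLa hLb hN2
  have hs : ∀ u w : K × K, (L u).1 * (L w).2 + (L u).2 * (L w).1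
      = ∑ σ, c σ * σ (tB φ β u w).1 + ∑ σ, d σ * σ (tB φ β u w).2 := by
    intro u w
    rw [← hN2]
    have := congrArg Prod.snd (h u w)
    rw [tB_snd] at this
    exact this
  have mulsum : ∀ (e : (K ≃ₐ[ZMod 2] K) → K) (p q : K), ∑ σ, e σ * σ (p + q)
      = ∑ σ, e σ * σ p + ∑ σ, e σ * σ q := by
    intro e p q
    simp [mul_add, Finset.sum_add_distrib]
  have xx : ∀ σ τ, a σ * b τ + b σ * a τ
      = (if σ * (φ ^ 3)⁻¹ = τ * (φ ^ 2)⁻¹ then c (σ * (φ ^ 3)⁻¹) * (σ * (φ ^ 3)⁻¹) 1 else 0)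
      + (if σ * (φ ^ 2)⁻¹ = τ * (φ ^ 3)⁻¹ then c (σ * (φ ^ 2)⁻¹) * (σ * (φ ^ 2)⁻¹) 1 else 0) := by
    apply ev_inj
    intro x y
    have := hs (x, 0) (y, 0)
    rw [hLa, hLb, hLa, hLb, tB_fst, tB_snd] at this
    simp only [map_zero, mul_zero, zero_mul, add_zero, Finset.sum_const_zero] at this
    rw [ev_prod, ev_prod, ev_add, mulsum] at this
    rw [this, ← ev_add, ← ev_twist, ← ev_twist]
    simp only [one_mul]
  have xy : ∀ σ τ, a σ * b' τ + b σ * a' τ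
      = (if σ * (φ ^ 2)⁻¹ = τ * φ⁻¹ then c (σ * (φ ^ 2)⁻¹) * (σ * (φ ^ 2)⁻¹) 1 else 0)
      + (if σ * 1⁻¹ = τ * 1⁻¹ then d (σ * 1⁻¹) * (σ * 1⁻¹) 1 else 0) := by
    apply ev_inj
    intro x y
    have := hs (x, 0) (0, y)
    rw [hLa, hLb, hLa, hLb, tB_fst, tB_snd] at this
    simp only [map_zero, mul_zero, zero_mul, add_zero, zero_add, Finset.sum_const_zero] at this
    rw [ev_prod, ev_prod, ev_add] at this
    rw [this, ← ev_add, ← ev_twist, ← ev_twist]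
    simp only [one_mul, AlgEquiv.one_apply]
  have yy : ∀ σ τ, a' σ * b' τ + b' σ * a' τ
      = (if σ * φ⁻¹ = τ * 1⁻¹ then c (σ * φ⁻¹) * (σ * φ⁻¹) β else 0)
      + (if σ * 1⁻¹ = τ * φ⁻¹ then c (σ * 1⁻¹) * (σ * 1⁻¹) β else 0) := by
    apply ev_inj
    intro x y
    have := hs (0, x) (0, y)
    rw [hLa, hLb, hLa, hLb, tB_fst, tB_snd] at this
    simp only [map_zero, mul_zero, zero_mul, add_zero, zero_add, Finset.sum_const_zero] at this
    rw [ev_prod, ev_prod, ev_add, mulsum] at this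
    rw [this, ← ev_add, ← ev_twist, ← ev_twist]
    simp only [AlgEquiv.one_apply]
  have hc : ∀ ρ, c ρ = 0 := by
    intro ρ
    by_contra hcρ
    have e1 := xx (ρ * φ ^ 2) (ρ * φ ^ 3)
    rw [if_neg, if_pos] at e1
    rotate_left
    · simp
    · intro hh
      apply h2
      have : ρ * φ ^ 2 * (φ ^ 3)⁻¹ = ρ * φ⁻¹ := by group
      rw [this] at hh
      have : ρ * φ ^ 3 * (φ ^ 2)⁻¹ = ρ * φ := by group
      rw [this] at hh
      have := mul_left_cancel hh
      rw [sq]; nth_rewrite 1 [← this]; simp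
    have e2 := xy (ρ * φ ^ 2) ρ
    rw [if_neg, if_neg] at e2
    rotate_left
    · intro hh; apply h2; simpa using hh
    · intro hh; apply h1; simpa using hh
    have e3 := xy (ρ * φ ^ 3) ρ
    rw [if_neg, if_neg] at e3
    rotate_left
    · intro hh; apply h3; simpa using hh
    · intro hh
      apply h2
      have : ρ * φ ^ 3 * (φ ^ 2)⁻¹ = ρ * φ := by group
      rw [this] at hh
      have := mul_left_cancel hh
      rw [sq]; nth_rewrite 1 [this]; simp
    have e4 := yy ρ (ρ * φ)
    rw [if_neg, if_pos] at e4
    rotate_left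
    · simp
    · intro hh
      apply h2
      have : ρ * φ * 1⁻¹ = ρ * φ := by group
      rw [this] at hh
      have := mul_left_cancel hh
      rw [sq]; nth_rewrite 1 [← this]; simp
    simp only [mul_inv_cancel_right, map_one, mul_one, zero_add, add_zero, inv_one] at e1 e2 e3 e4
    have hz := det_zero (p := a (ρ * φ ^ 2)) (q := b (ρ * φ ^ 2)) (r := a (ρ * φ ^ 3))
      (s := b (ρ * φ ^ 3)) (x := a' ρ) (y := b' ρ) (by
        rw [mul_comm (a (ρ * φ ^ 3)), e1]; exact hcρ)
      (by rw [mul_comm (a' ρ), e2]) (by rw [mul_comm (a' ρ), e3])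
    rw [hz.1, hz.2] at e4
    simp only [zero_mul, add_zero] at e4
    rcases mul_eq_zero.1 e4.symm with h' | h'
    · exact hcρ h'
    · exact hβ (by simpa using h')
  simp only [hc, zero_mul, ite_self, add_zero, zero_add, inv_one, mul_one, map_one] at xx xy yy
  have hN3 : ∀ z, (N (z, 0)).2 = 0 := by
    intro z
    rw [hN2]; simp [hc]
  refine ⟨hN3, ?_⟩
  obtain ⟨τ, hτ⟩ : ∃ τ, d τ ≠ 0 := by
    by_contra hcon
    push Not at hcon
    obtain ⟨⟨z1, z2⟩, hz⟩ := hN.2 (0, 1)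
    have := congrArg Prod.snd hz
    rw [hN2] at this
    simp [hc, hcon] at this
  have hdet : a τ * b' τ + b τ * a' τ ≠ 0 := by rw [xy, if_pos rfl]; exact hτ
  have hdet' : a τ * b' τ + a' τ * b τ ≠ 0 := by rwa [mul_comm (a' τ)]
  have hP : ∀ σ, σ ≠ τ → a σ = 0 ∧ b σ = 0 := by
    intro σ hσ
    refine det_zero hdet' ?_ ?_
    · have := xx τ σ
      rw [mul_comm (a σ)]; exact this
    · have := xy σ τ
      rw [if_neg hσ] at this
      rw [← this]; ring
  have hQ : ∀ σ, σ ≠ τ → a' σ = 0 ∧ b' σ = 0 := by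
    intro σ hσ
    refine det_zero hdet' ?_ ?_
    · have := xy τ σ
      rw [if_neg hσ.symm] at this
      rw [← this]; ring
    · have := yy τ σ
      rw [mul_comm (a' σ)]; exact this
  refine ⟨τ, a τ, a' τ, b τ, b' τ, hdet', fun x y => ?_⟩
  have sing : ∀ (e : (K ≃ₐ[ZMod 2] K) → K) (x : K), (∀ σ, σ ≠ τ → e σ = 0) →
      ∑ σ, e σ * σ x = e τ * τ x := by
    intro e x he
    rw [Finset.sum_eq_single τ]
    · intro σ _ hσ; rw [he σ hσ, zero_mul]
    · simp
  ext
  · rw [hLa, sing a x fun σ hσ => (hP σ hσ).1, sing a' y fun σ hσ => (hQ σ hσ).1]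
  · rw [hLb, sing b x fun σ hσ => (hP σ hσ).2, sing b' y fun σ hσ => (hQ σ hσ).2]
open Classical in
/-- coefficient matrix of the first component of `tB` on semilinear inputs. -/
noncomputable def lhsM (ψ τ : K ≃ₐ[ZMod 2] K) (β' p r s t : K) :
    (K ≃ₐ[ZMod 2] K) → (K ≃ₐ[ZMod 2] K) → K := fun σ ρ =>
  (if σ = τ * ψ ^ (3 : ℤ) ∧ ρ = τ * ψ ^ (2 : ℤ) then (ψ ^ 3) p * (ψ ^ 2) s else 0)
  + (if σ = τ * ψ ^ (2 : ℤ) ∧ ρ = τ * ψ ^ (3 : ℤ) then (ψ ^ 2) p * (ψ ^ 3) s else 0)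
  + (if σ = τ * ψ ^ (2 : ℤ) ∧ ρ = τ * ψ ^ (1 : ℤ) then (ψ ^ 2) p * ψ t else 0)
  + (if σ = τ * ψ ^ (1 : ℤ) ∧ ρ = τ * ψ ^ (2 : ℤ) then ψ r * (ψ ^ 2) s else 0)
  + ((if σ = τ * ψ ^ (1 : ℤ) ∧ ρ = τ * ψ ^ (0 : ℤ) then β' * (ψ r * t) else 0)
  + (if σ = τ * ψ ^ (0 : ℤ) ∧ ρ = τ * ψ ^ (1 : ℤ) then β' * (r * ψ t) else 0))

lemma lhsM_spec (ψ τ : K ≃ₐ[ZMod 2] K) (hcomm : τ * ψ = ψ * τ) (β' p r s t x y : K) :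
    (tB ψ β' (p * τ x, r * τ x) (s * τ y, t * τ y)).1 = ev (lhsM ψ τ β' p r s t) x y := by
  classical
  have c1 : ∀ x, ψ (τ x) = (τ * ψ ^ (1 : ℤ)) x := by
    intro x; rw [zpow_one, hcomm]; rfl
  have c2 : ∀ x, (ψ ^ 2) (τ x) = (τ * ψ ^ (2 : ℤ)) x := by
    intro x
    have : τ * ψ ^ (2 : ℤ) = ψ ^ 2 * τ := by
      have := (show Commute τ ψ from hcomm).pow_right 2
      exact_mod_cast this
    rw [this]; rfl
  have c3 : ∀ x, (ψ ^ 3) (τ x) = (τ * ψ ^ (3 : ℤ)) x := by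
    intro x
    have : τ * ψ ^ (3 : ℤ) = ψ ^ 3 * τ := by
      have := (show Commute τ ψ from hcomm).pow_right 3
      exact_mod_cast this
    rw [this]; rfl
  have c0 : ∀ x, τ x = (τ * ψ ^ (0 : ℤ)) x := by
    intro x; simp
  rw [tB_fst]
  unfold lhsM
  simp only [← ev_add, ← ev_single, ← c1, ← c2, ← c3, ← c0, map_mul]
  ring

open Classical in
noncomputable def xxM (φ : K ≃ₐ[ZMod 2] K) (c : (K ≃ₐ[ZMod 2] K) → K) :
    (K ≃ₐ[ZMod 2] K) → (K ≃ₐ[ZMod 2] K) → K := fun σ ρ =>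
  (if σ * (φ ^ (3 : ℤ))⁻¹ = ρ * (φ ^ (2 : ℤ))⁻¹ then c (σ * (φ ^ (3 : ℤ))⁻¹) else 0)
  + (if σ * (φ ^ (2 : ℤ))⁻¹ = ρ * (φ ^ (3 : ℤ))⁻¹ then c (σ * (φ ^ (2 : ℤ))⁻¹) else 0)

open Classical in
noncomputable def xyM (φ : K ≃ₐ[ZMod 2] K) (c d : (K ≃ₐ[ZMod 2] K) → K) :
    (K ≃ₐ[ZMod 2] K) → (K ≃ₐ[ZMod 2] K) → K := fun σ ρ =>
  (if σ * (φ ^ (2 : ℤ))⁻¹ = ρ * (φ ^ (1 : ℤ))⁻¹ then c (σ * (φ ^ (2 : ℤ))⁻¹) else 0)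
  + (if σ * (φ ^ (0 : ℤ))⁻¹ = ρ * (φ ^ (0 : ℤ))⁻¹ then d (σ * (φ ^ (0 : ℤ))⁻¹) else 0)

open Classical in
noncomputable def yyM (φ : K ≃ₐ[ZMod 2] K) (β : K) (c : (K ≃ₐ[ZMod 2] K) → K) :
    (K ≃ₐ[ZMod 2] K) → (K ≃ₐ[ZMod 2] K) → K := fun σ ρ =>
  (if σ * (φ ^ (1 : ℤ))⁻¹ = ρ * (φ ^ (0 : ℤ))⁻¹ then
    c (σ * (φ ^ (1 : ℤ))⁻¹) * (σ * (φ ^ (1 : ℤ))⁻¹) β else 0)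
  + (if σ * (φ ^ (0 : ℤ))⁻¹ = ρ * (φ ^ (1 : ℤ))⁻¹ then
    c (σ * (φ ^ (0 : ℤ))⁻¹) * (σ * (φ ^ (0 : ℤ))⁻¹) β else 0)

/-- Step B: comparing first components. -/
lemma stepB (φ ψ : K ≃ₐ[ZMod 2] K) (h1 : φ ≠ 1) (h2 : φ ^ 2 ≠ 1) (h3 : φ ^ 3 ≠ 1)
    (hcomm : ∀ σ τ : K ≃ₐ[ZMod 2] K, σ * τ = τ * σ)
    (β β' : K) (hβ' : β' ≠ 0) (L N : K × K →ₗ[ZMod 2] K × K)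
    (hN : Function.Bijective N)
    (h : ∀ u w, tB ψ β' (L u) (L w) = N (tB φ β u w))
    (hN3 : ∀ z, (N (z, 0)).2 = 0) (τ : K ≃ₐ[ZMod 2] K) (a a' b b' : K)
    (hdet : a * b' + a' * b ≠ 0)
    (hL : ∀ x y, L (x, y) = (a * τ x + a' * τ y, b * τ x + b' * τ y)) :
    (φ = ψ ∨ φ = ψ⁻¹) ∧ (φ = ψ → β' = τ β) := by
  classical
  obtain ⟨c, d, hN1⟩ := exists_linearized₂ (LinearMap.fst _ _ _ ∘ₗ N)
  simp only [LinearMap.comp_apply, LinearMap.fst_apply] at hN1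
  have hs : ∀ u w : K × K, (tB ψ β' (L u) (L w)).1
      = ∑ σ, c σ * σ (tB φ β u w).1 + ∑ σ, d σ * σ (tB φ β u w).2 := by
    intro u w
    rw [← hN1, h]
  have mulsum : ∀ (e : (K ≃ₐ[ZMod 2] K) → K) (p q : K), ∑ σ, e σ * σ (p + q)
      = ∑ σ, e σ * σ p + ∑ σ, e σ * σ q := by
    intro e p q
    simp [mul_add, Finset.sum_add_distrib]
  have z0 : φ ^ (0 : ℤ) = 1 := zpow_zero _
  have z1 : φ ^ (1 : ℤ) = φ := zpow_one _
  have z2 : φ ^ (2 : ℤ) = φ ^ 2 := by norm_cast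
  have z3 : φ ^ (3 : ℤ) = φ ^ 3 := by norm_cast
  have tw := fun (φ₁ φ₂ : K ≃ₐ[ZMod 2] K) (x y : K) => ev_twist c 1 φ₁ φ₂ x y
  simp only [one_mul, map_one, mul_one] at tw
  have twd := fun (φ₁ φ₂ : K ≃ₐ[ZMod 2] K) (x y : K) => ev_twist d 1 φ₁ φ₂ x y
  simp only [one_mul, map_one, mul_one] at twd
  have xx : ∀ σ ρ, lhsM ψ τ β' a b a b σ ρ = xxM φ c σ ρ := by
    apply ev_inj
    intro x y
    rw [← lhsM_spec ψ τ (hcomm _ _)]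
    have := hs (x, 0) (y, 0)
    rw [hL, hL, tB_snd φ, tB_fst φ] at this
    simp only [map_zero, mul_zero, zero_mul, add_zero, zero_add, Finset.sum_const_zero] at this
    rw [this, mulsum]
    unfold xxM
    rw [← ev_add, ← tw, ← tw, z2, z3]
  have xy : ∀ σ ρ, lhsM ψ τ β' a b a' b' σ ρ = xyM φ c d σ ρ := by
    apply ev_inj
    intro x y
    rw [← lhsM_spec ψ τ (hcomm _ _)]
    have := hs (x, 0) (0, y)
    rw [hL, hL, tB_snd φ, tB_fst φ] at this
    simp only [map_zero, mul_zero, zero_mul, add_zero, zero_add, Finset.sum_const_zero] at this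
    rw [this]
    unfold xyM
    rw [← ev_add, ← tw, ← twd, z1, z2, z0]
    rfl
  have yy : ∀ σ ρ, lhsM ψ τ β' a' b' a' b' σ ρ = yyM φ β c σ ρ := by
    apply ev_inj
    intro x y
    rw [← lhsM_spec ψ τ (hcomm _ _)]
    have := hs (0, x) (0, y)
    rw [hL, hL, tB_snd φ, tB_fst φ] at this
    simp only [map_zero, mul_zero, zero_mul, add_zero, zero_add, Finset.sum_const_zero] at this
    rw [this, mulsum]
    unfold yyM
    rw [← ev_add, ← ev_twist, ← ev_twist, z1, z0]
    rfl
  obtain ⟨ρ, hρ⟩ : ∃ ρ, c ρ ≠ 0 := by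
    by_contra hcon
    push Not at hcon
    have : N (1, 0) = N 0 := by
      rw [map_zero]
      ext
      · rw [hN1]; simp [hcon]
      · exact hN3 1
    have := congrArg Prod.fst (hN.1 this)
    simp at this
  have q1 : ∀ σ : K ≃ₐ[ZMod 2] K, ∀ i j : ℤ, σ * φ ^ i * (φ ^ j)⁻¹ = σ * φ ^ (i - j) := by
    intro σ i j
    rw [mul_assoc, ← zpow_neg, ← zpow_add, sub_eq_add_neg]
  have hne1 : φ ^ (-1 : ℤ) ≠ 1 := by simpa using h1
  have hne2 : φ ^ (-2 : ℤ) ≠ 1 := by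
    rw [zpow_neg, z2]; simpa using h2
  have hne3 : φ ^ (-3 : ℤ) ≠ 1 := by
    rw [zpow_neg, z3]; simpa using h3
  have q2 : ∀ i j : ℤ, (i - j = 1 ∨ i - j = 2 ∨ i - j = 3 ∨ i - j = -1 ∨ i - j = -2 ∨ i - j = -3) →
      (φ ^ i = φ ^ j ↔ False) := by
    intro i j hij
    rw [iff_false]
    intro hh
    have : φ ^ (i - j) = 1 := by rw [zpow_sub, hh, mul_inv_cancel]
    rcases hij with e | e | e | e | e | e <;> rw [e] at this
    · exact h1 (z1 ▸ this)
    · exact h2 (z2 ▸ this)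
    · exact h3 (z3 ▸ this)
    · exact hne1 this
    · exact hne2 this
    · exact hne3 this
  constructor
  · by_contra hcon
    push Not at hcon
    have e := xx (ρ * φ ^ (3 : ℤ)) (ρ * φ ^ (2 : ℤ))
    unfold xxM at e
    simp only [q1, mul_right_inj] at e
    simp only [q2, Int.reduceSub, Int.reduceNeg, Int.reduceEq, true_or, or_true, if_false, add_zero, sub_self, zpow_zero, mul_one,
      if_true, z3, z2] at e
    have aux : ∀ i j : ℤ, ρ * φ ^ 3 = τ * ψ ^ i ∧ ρ * φ ^ 2 = τ * ψ ^ j →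
        φ = ψ ^ (i - j) := by
      rintro i j ⟨e1, e2⟩
      have : ρ * φ ^ 3 = ρ * φ ^ 2 * φ := by rw [mul_assoc, ← pow_succ]
      rw [this, e2, mul_assoc] at e1
      have e3 := mul_left_cancel e1
      rw [zpow_sub, hcomm, ← e3]; group
    have aux1 : ∀ i j : ℤ, i - j = 1 → ¬ (ρ * φ ^ 3 = τ * ψ ^ i ∧ ρ * φ ^ 2 = τ * ψ ^ j) := by
      intro i j hij hh
      have := aux i j hh
      rw [hij, zpow_one] at this
      exact hcon.1 this
    have aux2 : ∀ i j : ℤ, i - j = -1 → ¬ (ρ * φ ^ 3 = τ * ψ ^ i ∧ ρ * φ ^ 2 = τ * ψ ^ j) := by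
      intro i j hij hh
      have := aux i j hh
      rw [hij, zpow_neg, zpow_one] at this
      exact hcon.2 this
    apply hρ
    rw [← e]
    unfold lhsM
    rw [if_neg (aux1 _ _ (by norm_num)), if_neg (aux2 _ _ (by norm_num)),
      if_neg (aux1 _ _ (by norm_num)), if_neg (aux2 _ _ (by norm_num)),
      if_neg (aux1 _ _ (by norm_num)), if_neg (aux2 _ _ (by norm_num))]
    simp
  · rintro rfl
    have ev2 : ∀ i j : ℤ, ∀ p r s t : K, lhsM φ τ β' p r s t (τ * φ ^ i) (τ * φ ^ j) =
      (if φ ^ i = φ ^ (3 : ℤ) ∧ φ ^ j = φ ^ (2 : ℤ) then (φ ^ 3) p * (φ ^ 2) s else 0)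
      + (if φ ^ i = φ ^ (2 : ℤ) ∧ φ ^ j = φ ^ (3 : ℤ) then (φ ^ 2) p * (φ ^ 3) s else 0)
      + (if φ ^ i = φ ^ (2 : ℤ) ∧ φ ^ j = φ ^ (1 : ℤ) then (φ ^ 2) p * φ t else 0)
      + (if φ ^ i = φ ^ (1 : ℤ) ∧ φ ^ j = φ ^ (2 : ℤ) then φ r * (φ ^ 2) s else 0)
      + ((if φ ^ i = φ ^ (1 : ℤ) ∧ φ ^ j = φ ^ (0 : ℤ) then β' * (φ r * t) else 0)
      + (if φ ^ i = φ ^ (0 : ℤ) ∧ φ ^ j = φ ^ (1 : ℤ) then β' * (r * φ t) else 0)) := by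
      intro i j p r s t
      simp only [lhsM, mul_right_inj]
    have E1 := xx (τ * φ ^ (3 : ℤ)) (τ * φ ^ (2 : ℤ))
    have E2 := xx (τ * φ ^ (1 : ℤ)) (τ * φ ^ (0 : ℤ))
    have E3 := xy (τ * φ ^ (0 : ℤ)) (τ * φ ^ (-1 : ℤ))
    have E4 := yy (τ * φ ^ (3 : ℤ)) (τ * φ ^ (2 : ℤ))
    have E5 := xy (τ * φ ^ (4 : ℤ)) (τ * φ ^ (3 : ℤ))
    have E6 := yy (τ * φ ^ (1 : ℤ)) (τ * φ ^ (0 : ℤ))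
    have E7 := xy (τ * φ ^ (2 : ℤ)) (τ * φ ^ (1 : ℤ))
    rw [ev2] at E1 E2 E3 E4 E5 E6 E7
    unfold xxM at E1 E2
    unfold xyM at E3 E5 E7
    unfold yyM at E4 E6
    simp only [q1, mul_right_inj] at E1 E2 E3 E4 E5 E6 E7
    simp only [q2, Int.reduceSub, Int.reduceNeg, Int.reduceEq, true_or, or_true, and_false, false_and, if_false, if_true, and_true,
      add_zero, zero_add, sub_self] at E1 E2 E3 E4 E5 E6 E7
    simp only [zpow_zero, mul_one] at E1 E6 E7
    rw [← E3] at E2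
    rw [← E5, zero_mul] at E4
    have hb : b = 0 := by simpa [hβ'] using E2
    have ha' : a' = 0 := by simpa using E4
    subst hb ha'
    have hab : a ≠ 0 ∧ b' ≠ 0 := by simpa using hdet
    have e1 : φ b' = (φ ^ 3) a := by
      have h5 : (φ ^ 2) a * φ b' = (φ ^ 2) a * (φ ^ 3) a := by rw [E7, ← E1, mul_comm]
      exact mul_left_cancel₀ (by simpa using hab.1) h5
    have e2 : b' = (φ ^ 2) a := by
      apply φ.injective
      rw [e1, pow_succ' φ 2]; rfl
    rw [← E1, ← e1, ← e2] at E6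
    have h6 : (φ b' * b') * β' = (φ b' * b') * τ β := by rw [← E6]; ring
    exact mul_left_cancel₀ (mul_ne_zero (by simpa using hab.2) hab.2) h6

end Linearized

section Assembly

variable {K : Type*} [Field K] [Finite K] [Algebra (ZMod 2) K]

/-- the Frobenius automorphism -/
noncomputable def Frob (K : Type*) [Field K] [Finite K] [Algebra (ZMod 2) K] : K ≃ₐ[ZMod 2] K :=
  FiniteField.frobeniusAlgEquivOfAlgebraic (ZMod 2) K

lemma Frob_pow_apply (n : ℕ) (x : K) : (Frob K ^ n) x = x ^ (2 ^ n) := by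
  have h := congrFun (FiniteField.coe_frobeniusAlgEquivOfAlgebraic_iterate (ZMod 2) K n) x
  rw [ZMod.card] at h
  rw [← h, AlgEquiv.coe_pow, Frob]

lemma Frob_apply (x : K) : Frob K x = x ^ 2 := by
  have := Frob_pow_apply 1 x
  simpa using this

lemma taniguchi_eq (k : ℕ) (β : K) (p : K × K) : taniguchi k 1 β p =
    (((Frob K ^ k) ^ 3) p.1 * ((Frob K ^ k) ^ 2) p.1 + ((Frob K ^ k) ^ 2) p.1 * (Frob K ^ k) p.2
      + β * ((Frob K ^ k) p.2 * p.2), p.1 * p.2) := by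
  simp only [← pow_mul, Frob_pow_apply, taniguchi, one_mul]
  refine Prod.ext ?_ rfl
  simp only
  rw [mul_comm 2 k, mul_add, pow_add, mul_one, ← pow_add 2, pow_succ p.2, show k * 2 + k = k * 3 by ring]

lemma taniguchi_isQuad (k : ℕ) (β : K) : IsQuad (taniguchi k 1 β) (tB (Frob K ^ k) β) := by
  intro u w
  simp only [taniguchi_eq]
  refine Prod.ext ?_ ?_
  · simp only [Prod.fst_add, Prod.snd_add, tB_fst, map_add]
    ring
  · simp only [Prod.fst_add, Prod.snd_add, tB_snd]
    ring

lemma Frob_orderOf : orderOf (Frob K) = Module.finrank (ZMod 2) K :=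
  FiniteField.orderOf_frobeniusAlgEquivOfAlgebraic (ZMod 2) K

lemma fixed_of_coprime (k : ℕ) (hk : Nat.gcd k (Module.finrank (ZMod 2) K) = 1) (x : K)
    (hx : (Frob K ^ k) x = x) : x = 0 ∨ x = 1 := by
  have hc : (orderOf (Frob K)).Coprime k := by
    rw [Frob_orderOf]; exact Nat.Coprime.symm hk
  obtain ⟨n, hn⟩ := exists_pow_eq_self_of_coprime (Nat.Coprime.symm hc)
  have : ∀ n : ℕ, ((Frob K ^ k) ^ n) x = x := by
    intro n
    induction n with
    | zero => simp
    | succ n ih => rw [pow_succ, AlgEquiv.mul_apply, hx, ih]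
  have h := this n
  rw [hn, Frob_apply] at h
  have : x * (x - 1) = 0 := by linear_combination h
  rcases mul_eq_zero.1 this with h | h
  · exact Or.inl h
  · exact Or.inr (sub_eq_zero.1 h)

lemma taniguchi_APN [Fintype (K × K)] (k : ℕ) (hk : Nat.gcd k (Module.finrank (ZMod 2) K) = 1) (β : K)
    (hβ : ∀ x : K, x ^ (2 ^ k + 1) + x + β ≠ 0) : IsAPNForm (tB (Frob K ^ k) β) := by
  have hβ : ∀ x : K, (Frob K ^ k) x * x + x + β ≠ 0 := by
    intro x; rw [Frob_pow_apply, ← pow_succ]; exact hβ x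
  have hfix := fixed_of_coprime (K := K) k hk
  generalize Frob K ^ k = φ at *
  have h2 : (2 : K) = 0 := by
    have := K_add_self (1 : K); rw [← this]; norm_num
  intro a ha x
  constructor
  · intro h
    have e1 := congrArg Prod.fst h
    have e2 := congrArg Prod.snd h
    rw [tB_fst] at e1
    rw [tB_snd] at e2
    obtain ⟨a1, a2⟩ := a
    obtain ⟨x1, x2⟩ := x
    simp only [Prod.fst_zero, Prod.snd_zero] at e1 e2
    have hlam : ∃ l : K, x1 = l * a1 ∧ x2 = l * a2 := by
      by_cases h1 : a1 = 0
      · have h3 : a2 ≠ 0 := by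
          rintro rfl; exact ha (by rw [h1]; rfl)
        subst h1
        refine ⟨x2 / a2, ?_, by field_simp⟩
        have : x1 * a2 = 0 := by linear_combination e2
        simpa [h3] using this
      · refine ⟨x1 / a1, by field_simp, ?_⟩
        field_simp
        linear_combination e2 - x1 * a2 * h2
    obtain ⟨l, rfl, rfl⟩ := hlam
    simp only [map_mul] at e1
    have hp2 : ∀ z, (φ ^ 2) z = φ (φ z) := fun z => by rw [pow_two]; rfl
    have hp3 : ∀ z, (φ ^ 3) z = φ (φ (φ z)) := fun z => by rw [pow_three]; rfl
    simp only [hp2, hp3] at e1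
    have key : φ (φ (l + φ l)) * (φ (φ a1) * φ (φ (φ a1)))
        + φ (l + φ l) * (φ (φ a1) * φ a2) + β * ((l + φ l) * (φ a2 * a2)) = 0 := by
      simp only [map_add]
      linear_combination e1
    have hmu : l + φ l = 0 := by
      by_contra hmu
      generalize l + φ l = μ at *
      have hφ : ∀ z : K, z ≠ 0 → φ z ≠ 0 := fun z hz => by simpa using hz
      by_cases h3 : a2 = 0
      · have h1 : a1 ≠ 0 := by
          rintro rfl; exact ha (by rw [h3]; rfl)
        subst h3
        simp only [map_zero, mul_zero, add_zero] at key
        have g1 := hφ _ h1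
        have g2 := hφ _ g1
        have g3 := hφ _ g2
        have g4 := hφ _ (hφ _ hmu)
        exact mul_ne_zero g4 (mul_ne_zero g2 g3) key
      · apply hβ (φ μ * φ (φ a1) / (a2 * μ))
        have g1 := hφ _ hmu
        have g2 := hφ _ h3
        simp only [map_div₀, map_mul]
        field_simp
        linear_combination key
    have hl : φ l = l := by
      linear_combination hmu - l * h2
    rcases hfix l hl with rfl | rfl
    · left; simp
    · right; simp
  · rintro (rfl | rfl)
    · simp
    · refine Prod.ext ?_ ?_
      · rw [tB_fst]
        simp only [Prod.fst_zero]
        linear_combination (((φ ^ 3) x.1 * (φ ^ 2) x.1) + (φ ^ 2) x.1 * φ x.2 + β * (φ x.2 * x.2)) * h2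
      · rw [tB_snd]
        simp only [Prod.snd_zero]
        linear_combination (x.1 * x.2) * h2

lemma surj_mul (e : K) (he : e ≠ 1) (y : K) : ∃ z, y = e * z + z := by
  have h2 : (2 : K) = 0 := by
    have := K_add_self (1 : K); rw [← this]; norm_num
  have : e + 1 ≠ 0 := fun h => he (by linear_combination h - h2)
  exact ⟨y / (e + 1), by field_simp⟩

/-- scaling by a pair of nonzero elements -/
noncomputable def scalePair (a b : K) (ha : a ≠ 0) (hb : b ≠ 0) : (K × K) ≃ₗ[ZMod 2] (K × K) :=
  LinearEquiv.prodCongr (LinearEquiv.restrictScalars (ZMod 2) (LinearEquiv.smulOfNeZero K K a ha))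
    (LinearEquiv.restrictScalars (ZMod 2) (LinearEquiv.smulOfNeZero K K b hb))

lemma scalePair_apply (a b : K) (ha : a ≠ 0) (hb : b ≠ 0) (p : K × K) :
    scalePair a b ha hb p = (a * p.1, b * p.2) := rfl

lemma taniguchi_stab [Fintype (K × K)] (k m : ℕ) (hm : 3 ≤ m) (hk2 : 2 * k < m)
    (hmK : Nat.card K = 2 ^ m) (hfr : Module.finrank (ZMod 2) K = m)
    (hk : Nat.gcd k m = 1) (β : K)
    (hβ : ∀ x : K, x ^ (2 ^ k + 1) + x + β ≠ 0)
    (p) (hp : p ∈ stabBent (tB (Frob K ^ k) β)) : p = 0 := by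
  obtain ⟨g, hg⟩ := IsCyclic.exists_generator (α := Kˣ)
  have hord : orderOf g = 2 ^ m - 1 := by
    rw [orderOf_eq_card_of_forall_mem_zpowers hg, Nat.card_units, hmK]
  set a : K := (g : K) with hadef
  have ha : a ≠ 0 := g.ne_zero
  have hne : ∀ n : ℕ, 0 < n → n < 2 ^ m - 1 → a ^ n ≠ 1 := by
    intro n h0 h1 h
    have : g ^ n = 1 := by ext; simpa using h
    have := orderOf_le_of_pow_eq_one h0 this
    omega
  set φ := Frob K ^ k with hφdef
  have hφ : ∀ z : K, z ≠ 0 → φ z ≠ 0 := fun z hz => by simpa using hz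
  have hp2 : ∀ z, (φ ^ 2) z = φ (φ z) := fun z => by rw [pow_two]; rfl
  have hp3 : ∀ z, (φ ^ 3) z = φ (φ (φ z)) := fun z => by rw [pow_three]; rfl
  have h2k : 2 ^ (2 * k + 1) ≤ 2 ^ m := Nat.pow_le_pow_right (by norm_num) (by omega)
  have h2k' : 2 ^ k ≤ 2 ^ (2 * k) := Nat.pow_le_pow_right (by norm_num) (by omega)
  have h8 : 2 ^ 3 ≤ 2 ^ m := Nat.pow_le_pow_right (by norm_num) hm
  have hs : 2 ^ (2 * k + 1) = 2 * 2 ^ (2 * k) := by ring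
  have hlt : 2 ^ (2 * k) + 1 < 2 ^ m - 1 := by
    by_cases hk3 : m = 3
    · subst hk3
      have : 2 ^ (2 * k) ≤ 2 ^ 2 := Nat.pow_le_pow_right (by norm_num) (by omega)
      omega
    · have : 2 ^ 4 ≤ 2 ^ m := Nat.pow_le_pow_right (by norm_num) (by omega)
      omega
  have he1 : φ (φ (φ a)) * φ (φ a) ≠ 1 := by
    intro h
    rw [← map_mul, ← map_mul, EmbeddingLike.map_eq_one_iff, EmbeddingLike.map_eq_one_iff,
      hφdef, Frob_pow_apply, ← pow_succ] at h
    exact hne _ (Nat.succ_pos _) (by omega) h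
  have he2 : φ (φ a) * a ≠ 1 := by
    intro h
    rw [← hp2, hφdef, ← pow_mul, Frob_pow_apply, ← pow_succ, mul_comm k 2] at h
    exact hne _ (Nat.succ_pos _) (by omega) h
  refine stabBent_trivial (taniguchi k 1 β) _ (taniguchi_isQuad k β)
    (taniguchi_APN k (by rw [hfr]; exact hk) β hβ) m (by omega) ?_
    (scalePair a (φ (φ a)) ha (hφ _ (hφ _ ha)))
    (scalePair (φ (φ (φ a)) * φ (φ a)) (φ (φ a) * a)
      (mul_ne_zero (hφ _ (hφ _ (hφ _ ha))) (hφ _ (hφ _ ha))) (mul_ne_zero (hφ _ (hφ _ ha)) ha))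
    ?_ ?_ p hp
  · rw [← Nat.card_eq_fintype_card, Nat.card_prod, hmK, ← pow_add]; congr 1; ring
  · intro x y
    simp only [scalePair_apply]
    refine Prod.ext ?_ ?_
    · simp only [tB_fst, map_mul, hp2, hp3, ← hφdef]
      ring
    · simp only [tB_snd, ← hφdef]
      ring
  · rintro ⟨y1, y2⟩
    obtain ⟨z1, h1⟩ := surj_mul _ he1 y1
    obtain ⟨z2, h2⟩ := surj_mul _ he2 y2
    exact ⟨(z1, z2), by rw [scalePair_apply]; exact Prod.ext h1 h2⟩

lemma two_eq_zero' : (2 : K) = 0 := by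
  have := K_add_self (1 : K); rw [← this]; norm_num

lemma adm_poly (hc : Nat.card K = 8) (b : K) (hb0 : b ≠ 0)
    (hb : ∀ x : K, x ^ 3 + x + b ≠ 0) : b ^ 3 + b + 1 = 0 := by
  have h2 : (2 : K) = 0 := two_eq_zero'
  have : Fintype K := Fintype.ofFinite K
  have h8 : ∀ x : K, x ^ 8 = x := by
    intro x
    have := FiniteField.pow_card x
    rwa [← Nat.card_eq_fintype_card, hc] at this
  have hfac : ∀ x : K, x * ((x + 1) * ((x ^ 3 + x + 1) * (x ^ 3 + x ^ 2 + 1))) = 0 := by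
    intro x
    have := h8 x
    grind
  have hb1 : b ≠ 1 := by
    rintro rfl
    obtain ⟨g, hg⟩ := IsCyclic.exists_generator (α := Kˣ)
    have hord : orderOf g = 7 := by
      rw [orderOf_eq_card_of_forall_mem_zpowers hg, Nat.card_units, hc]
    have hg1 : (g : K) ≠ 1 := by
      intro h
      have : g = 1 := Units.ext h
      rw [this, orderOf_one] at hord
      omega
    rcases mul_eq_zero.1 (hfac g) with h | h
    · exact g.ne_zero h
    rcases mul_eq_zero.1 h with h | h
    · exact hg1 (by linear_combination h - h2)
    rcases mul_eq_zero.1 h with h | h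
    · exact hb _ h
    · apply hb ((g : K) + 1)
      generalize (g : K) = x at *
      grind
  rcases mul_eq_zero.1 (hfac b) with h | h
  · exact absurd h hb0
  rcases mul_eq_zero.1 h with h | h
  · exact absurd (by linear_combination h - h2) hb1
  rcases mul_eq_zero.1 h with h | h
  · exact h
  · exfalso
    apply hb (b ^ 2)
    linear_combination b * (b * b + b + 1) * h - (b ^ 5 + b ^ 4 + b ^ 3) * h2

lemma adm_conj (b c : K) (hb : b ^ 3 + b + 1 = 0) (hc : c ^ 3 + c + 1 = 0) :
    c = b ∨ c = b ^ 2 ∨ c = b ^ 4 := by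
  have h2 : (2 : K) = 0 := two_eq_zero'
  have : (c - b) * ((c - b ^ 2) * (c - b ^ 4)) = 0 := by grind
  rcases mul_eq_zero.1 this with h | h
  · exact Or.inl (sub_eq_zero.1 h)
  rcases mul_eq_zero.1 h with h | h
  · exact Or.inr (Or.inl (sub_eq_zero.1 h))
  · exact Or.inr (Or.inr (sub_eq_zero.1 h))

lemma ccz_of_frob (k i : ℕ) (β : K) :
    CCZEquivalent (taniguchi k 1 β) (taniguchi k 1 (β ^ (2 ^ i))) := by
  set τ := Frob K ^ i with hτ
  have hcomm : ∀ n x, τ (((Frob K ^ k) ^ n) x) = ((Frob K ^ k) ^ n) (τ x) := by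
    intro n x
    rw [← AlgEquiv.mul_apply, ← AlgEquiv.mul_apply, hτ, ← pow_mul, ← pow_add, ← pow_add, add_comm]
  have hcomm1 : ∀ x, τ ((Frob K ^ k) x) = (Frob K ^ k) (τ x) := by
    intro x; simpa using hcomm 1 x
  let T : (K × K) ≃ₗ[ZMod 2] (K × K) := LinearEquiv.prodCongr τ.toLinearEquiv τ.toLinearEquiv
  have hT : ∀ p, T p = (τ p.1, τ p.2) := fun p => rfl
  let A : ((K × K) × (K × K)) ≃ₗ[ZMod 2] ((K × K) × (K × K)) := LinearEquiv.prodCongr T T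
  have hA : ∀ p, A p = (T p.1, T p.2) := fun p => rfl
  have hf : ∀ p, T (taniguchi k 1 β p) = taniguchi k 1 (β ^ (2 ^ i)) (T p) := by
    intro p
    rw [taniguchi_eq, taniguchi_eq, hT, hT, ← Frob_pow_apply, ← hτ]
    simp only [map_add, map_mul, hcomm, hcomm1]
  refine ⟨A, 0, A.toLinearMap.isLinear, A.bijective, ?_⟩
  ext ⟨u, v⟩
  simp only [add_zero, Set.mem_image, Set.mem_setOf_eq]
  constructor
  · rintro ⟨⟨p, q⟩, h, h'⟩
    simp only at h
    subst h
    rw [hA] at h'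
    obtain ⟨rfl, rfl⟩ := Prod.mk.inj h'
    exact hf p
  · intro h
    subst h
    refine ⟨(T.symm u, taniguchi k 1 β (T.symm u)), rfl, ?_⟩
    rw [hA, hf, T.apply_symm_apply]

lemma ccz_forward (m k ℓ : ℕ) (hm : 4 ≤ m) (hmK : Nat.card K = 2 ^ m)
    (hfr : Module.finrank (ZMod 2) K = m)
    (hk : 0 < k) (hk2 : 2 * k < m) (hℓ : 0 < ℓ) (hℓ2 : 2 * ℓ < m)
    (hgk : Nat.gcd k m = 1) (hgl : Nat.gcd ℓ m = 1)
    (β β' : K) (hβ0 : β ≠ 0) (hβ'0 : β' ≠ 0)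
    (hβ' : ∀ x : K, x ^ (2 ^ ℓ + 1) + x + β' ≠ 0)
    (h : CCZEquivalent (taniguchi k 1 β) (taniguchi ℓ 1 β')) :
    k = ℓ ∧ ∃ i : ℕ, i < m ∧ β' = β ^ (2 ^ i) := by
  have : Fintype (K × K) := Fintype.ofFinite _
  have hpow : ∀ σ : K ≃ₐ[ZMod 2] K, ∃ i < m, σ = Frob K ^ i := by
    intro σ
    obtain ⟨i, hi⟩ := (FiniteField.bijective_frobeniusAlgEquivOfAlgebraic_pow (ZMod 2) K).2 σ
    exact ⟨i.1, hfr ▸ i.2, hi.symm⟩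
  have hord : orderOf (Frob K) = m := by rw [Frob_orderOf, hfr]
  have hordk : orderOf (Frob K ^ k) = m := by
    rw [Nat.Coprime.orderOf_pow (by rw [hord]; exact Nat.Coprime.symm hgk), hord]
  have hne : ∀ n, 0 < n → n < m → (Frob K ^ k) ^ n ≠ 1 := by
    intro n h0 h1 h
    have := orderOf_le_of_pow_eq_one h0 h
    omega
  have h1 : Frob K ^ k ≠ 1 := by
    have := hne 1 (by omega) (by omega)
    rwa [pow_one] at this
  obtain ⟨L, N, hN, hLN⟩ := ccz_to_linear _ _ (tB (Frob K ^ k) β) (tB (Frob K ^ ℓ) β')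
    (taniguchi_isQuad k β) (taniguchi_isQuad ℓ β')
    (taniguchi_stab ℓ m (by omega) hℓ2 hmK hfr hgl β' hβ') h
  obtain ⟨hN3, τ, a, a', b, b', hdet, hL⟩ := stepA (Frob K ^ k) (Frob K ^ ℓ) h1
    (hne 2 (by omega) (by omega)) (hne 3 (by omega) (by omega)) β β' hβ0 L N hN hLN
  obtain ⟨hor, hβτ⟩ := stepB (Frob K ^ k) (Frob K ^ ℓ) h1
    (hne 2 (by omega) (by omega)) (hne 3 (by omega) (by omega)) (by
      intro σ τ
      obtain ⟨i, _, rfl⟩ := hpow σ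
      obtain ⟨j, _, rfl⟩ := hpow τ
      rw [← pow_add, ← pow_add, add_comm]) β β' hβ'0 L N hN hLN hN3 τ a a' b b' hdet hL
  have hkl : k = ℓ := by
    rcases hor with h | h
    · exact pow_injOn_Iio_orderOf (by rw [hord]; show k < m; omega)
        (by rw [hord]; show ℓ < m; omega) h
    · exfalso
      rw [eq_inv_iff_mul_eq_one, ← pow_add] at h
      have := orderOf_le_of_pow_eq_one (by omega) h
      omega
  refine ⟨hkl, ?_⟩
  obtain ⟨i, hi, rfl⟩ := hpow τ
  refine ⟨i, hi, ?_⟩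
  rw [hβτ (by rw [hkl]), Frob_pow_apply]

end Assembly

/-- (Main theorem) Let `m ≥ 3`, `0 < k, ℓ < m/2` coprime to `m`, and `β, β' ∈ F_{2^m}^*`
be such that `X^(2^k+1) + X + β` and `X^(2^ℓ+1) + X + β'` have no roots in `F_{2^m}`.
The Taniguchi APN functions `f_{k,1,β}` and `f_{ℓ,1,β'}` are CCZ-equivalent if and only
if `k = ℓ` and `β' = β^(2^i)` for some `i ∈ {0, …, m-1}`. -/
theorem taniguchi_main_equivalence (m k ℓ : ℕ) (hm : 3 ≤ m)
    (hk : 0 < k) (hk2 : 2 * k < m) (hℓ : 0 < ℓ) (hℓ2 : 2 * ℓ < m)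
    (hgk : Nat.gcd k m = 1) (hgl : Nat.gcd ℓ m = 1)
    (β β' : GaloisField 2 m) (hβ0 : β ≠ 0) (hβ'0 : β' ≠ 0)
    (hβ : ∀ x : GaloisField 2 m, x ^ (2 ^ k + 1) + x + β ≠ 0)
    (hβ' : ∀ x : GaloisField 2 m, x ^ (2 ^ ℓ + 1) + x + β' ≠ 0) :
    CCZEquivalent (taniguchi k (1 : GaloisField 2 m) β)
        (taniguchi ℓ (1 : GaloisField 2 m) β') ↔
      (k = ℓ ∧ ∃ i : ℕ, i < m ∧ β' = β ^ (2 ^ i)) := by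
  have hmK : Nat.card (GaloisField 2 m) = 2 ^ m := GaloisField.card 2 m (by omega)
  have hfr : Module.finrank (ZMod 2) (GaloisField 2 m) = m := GaloisField.finrank 2 (by omega)
  constructor
  · intro h
    by_cases hm3 : m = 3
    · subst hm3
      obtain rfl : k = 1 := by omega
      obtain rfl : ℓ = 1 := by omega
      refine ⟨rfl, ?_⟩
      norm_num at hβ hβ' hmK
      rcases adm_conj β β' (adm_poly hmK β hβ0 hβ) (adm_poly hmK β' hβ'0 hβ') with h | h | h
      · exact ⟨0, by norm_num, by simpa using h⟩
      · exact ⟨1, by norm_num, by simpa using h⟩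
      · exact ⟨2, by norm_num, by simpa using h⟩
    · exact ccz_forward m k ℓ (by omega) hmK hfr hk hk2 hℓ hℓ2 hgk hgl β β' hβ0 hβ'0 hβ' h
  · rintro ⟨rfl, i, -, rfl⟩
    exact ccz_of_frob k i β
end
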